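/- arXiv:1407.2664 — 2 statements merged into one kernel-verified Lean document; each statement's English description precedes it below -/
import Mathlib

section
/- Let T be a squarefree semisimple Λ-module with projective cover P, and let d ≥ 1. Then the following are equivalent: (i) no d-dimensional Λ-module with top isomorphic to T has a proper top-stable degeneration; (ii) every Λ-submodule C ⊆ JP with dim_K(P/C) = d is invariant under all Λ-endomorphisms of P. -/
open Module

/-- The Jacobson radical `J` of the ring `Λ` (intersection of the maximal left ideals). -/
noncomputable def jacRad (Λ : Type) [Ring Λ] : Ideal Λ := Ideal.jacobson ⊥

/-- The submodule `J • M` of a `Λ`-module `M`. -/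
noncomputable def jrad (Λ : Type) [Ring Λ] (M : Type) [AddCommGroup M] [Module Λ M] :
    Submodule Λ M :=
  Submodule.span Λ {x : M | ∃ a ∈ jacRad Λ, ∃ m : M, a • m = x}

/-- The underlying space of the `d`-dimensional representation `ρ : Λ →ₐ[K] M_d(K)`. -/
def RepSpace (K : Type) [Field K] (d : ℕ) {Λ : Type} [Ring Λ] [Algebra K Λ]
    (ρ : Λ →ₐ[K] Matrix (Fin d) (Fin d) K) : Type := Fin d → K

section RepSpace
variable (K : Type) [Field K] (d : ℕ) {Λ : Type} [Ring Λ] [Algebra K Λ]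
  (ρ : Λ →ₐ[K] Matrix (Fin d) (Fin d) K)

instance : AddCommGroup (RepSpace K d ρ) := inferInstanceAs (AddCommGroup (Fin d → K))
instance : Module K (RepSpace K d ρ) := inferInstanceAs (Module K (Fin d → K))

/-- The `Λ`-module structure on `K^d` induced by the representation `ρ`. -/
noncomputable instance RepSpace.moduleLambda : Module Λ (RepSpace K d ρ) :=
  Module.compHom (Fin d → K)
    ((Matrix.toLinAlgEquiv' :
        Matrix (Fin d) (Fin d) K ≃ₐ[K] Module.End K (Fin d → K)).toAlgHom.toRingHom.comp
      ρ.toRingHom)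

instance : IsScalarTower K Λ (RepSpace K d ρ) := by
  constructor
  intro k a v
  show (Matrix.toLinAlgEquiv'.toAlgHom.toRingHom.comp ρ.toRingHom (k • a)) v
      = k • ((Matrix.toLinAlgEquiv'.toAlgHom.toRingHom.comp ρ.toRingHom a) v)
  have h : (Matrix.toLinAlgEquiv'.toAlgHom.toRingHom.comp ρ.toRingHom (k • a))
      = k • (Matrix.toLinAlgEquiv'.toAlgHom.toRingHom.comp ρ.toRingHom a) := by
    simp [map_smul]
  rw [h]; rfl

end RepSpace

/-- `M_τ` is a degeneration of `M_ρ`: having fixed a `K`-basis `b` of `Λ` (which identifies the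
space of `K`-linear maps `Λ → M_d(K)` with an affine space with polynomial coordinate
functions indexed by `ι × Fin d × Fin d`), the point `τ` lies in the Zariski closure (the zero
locus of all polynomials vanishing on the orbit) of the conjugation orbit of `ρ` under
`GL_d(K)`. -/
def IsDegeneration {K Λ ι : Type} [Field K] [Ring Λ] [Algebra K Λ] [Fintype ι]
    (b : Basis ι K Λ) (d : ℕ) (ρ τ : Λ →ₐ[K] Matrix (Fin d) (Fin d) K) : Prop :=
  ∀ p : MvPolynomial (ι × Fin d × Fin d) K,
    (∀ g : GL (Fin d) K,
      MvPolynomial.eval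
        (fun x => ((g : Matrix (Fin d) (Fin d) K) * ρ (b x.1) *
            ((g⁻¹ : GL (Fin d) K) : Matrix (Fin d) (Fin d) K)) x.2.1 x.2.2) p = 0) →
    MvPolynomial.eval (fun x => τ (b x.1) x.2.1 x.2.2) p = 0

section Aux1

variable {Λ : Type} [Ring Λ]

theorem aux_jrad_eq (M : Type) [AddCommGroup M] [Module Λ M] :
    jrad Λ M = jacRad Λ • (⊤ : Submodule Λ M) := by
  apply le_antisymm
  · refine Submodule.span_le.2 ?_
    rintro x ⟨a, ha, m, rfl⟩
    exact Submodule.smul_mem_smul ha trivial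
  · refine Submodule.smul_le.2 ?_
    intro a ha m _
    exact Submodule.subset_span ⟨a, ha, m, rfl⟩

theorem aux_jrad_map {M N : Type} [AddCommGroup M] [Module Λ M] [AddCommGroup N] [Module Λ N]
    (f : M →ₗ[Λ] N) (hf : Function.Surjective f) : (jrad Λ M).map f = jrad Λ N := by
  rw [aux_jrad_eq, aux_jrad_eq, Submodule.map_smul'', Submodule.map_top,
    LinearMap.range_eq_top.2 hf]

theorem aux_jrad_map_le {M N : Type} [AddCommGroup M] [Module Λ M] [AddCommGroup N] [Module Λ N]
    (f : M →ₗ[Λ] N) : (jrad Λ M).map f ≤ jrad Λ N := by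
  rw [aux_jrad_eq, aux_jrad_eq, Submodule.map_smul'']
  exact smul_mono_right _ le_top

/-- Nakayama. -/
theorem aux_nak {M : Type} [AddCommGroup M] [Module Λ M] [Module.Finite Λ M]
    (N : Submodule Λ M) (h : N ⊔ jrad Λ M = ⊤) : N = ⊤ := by
  have h1 : (⊤ : Submodule Λ (M ⧸ N)) ≤ Ring.jacobson Λ • (⊤ : Submodule Λ (M ⧸ N)) := by
    have h2 := congrArg (Submodule.map N.mkQ) h
    rw [Submodule.map_sup, aux_jrad_map _ N.mkQ_surjective, Submodule.map_top, N.range_mkQ,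
      aux_jrad_eq] at h2
    have h3 : Submodule.map N.mkQ N = ⊥ := by
      simp
    rw [h3, bot_sup_eq] at h2
    rw [← Ideal.jacobson_bot]
    exact h2.ge
  have h4 := Submodule.FG.eq_bot_of_le_jacobson_smul (Module.Finite.fg_top) h1
  have h5 := Submodule.subsingleton_iff Λ |>.1 (subsingleton_of_bot_eq_top h4.symm)
  exact Submodule.Quotient.subsingleton_iff.1 h5

/-- Tops under a surjection with small kernel. -/
theorem aux_top {P N : Type} [AddCommGroup P] [Module Λ P] [AddCommGroup N] [Module Λ N]
    (f : P →ₗ[Λ] N) (hf : Function.Surjective f) (hk : LinearMap.ker f ≤ jrad Λ P) :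
    Nonempty ((N ⧸ jrad Λ N) ≃ₗ[Λ] (P ⧸ jrad Λ P)) := by
  have hs : Function.Surjective ((jrad Λ N).mkQ ∘ₗ f) :=
    (Submodule.mkQ_surjective _).comp hf
  have hker : LinearMap.ker ((jrad Λ N).mkQ ∘ₗ f) = jrad Λ P := by
    rw [LinearMap.ker_comp, Submodule.ker_mkQ, ← aux_jrad_map f hf, Submodule.comap_map_eq]
    exact sup_eq_left.2 hk
  exact ⟨((Submodule.quotEquivOfEq _ _ hker).symm.trans
    (LinearMap.quotKerEquivOfSurjective _ hs)).symm⟩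

/-- Projective cover: lifting an isomorphism of tops. -/
theorem aux_cover {P N : Type} [AddCommGroup P] [Module Λ P] [AddCommGroup N] [Module Λ N]
    [Module.Finite Λ N] (hP : Module.Projective Λ P)
    (e : (P ⧸ jrad Λ P) ≃ₗ[Λ] (N ⧸ jrad Λ N)) :
    ∃ f : P →ₗ[Λ] N, Function.Surjective f ∧ LinearMap.ker f ≤ jrad Λ P := by
  obtain ⟨f, hf⟩ := Module.projective_lifting_property (jrad Λ N).mkQ
    (e.toLinearMap ∘ₗ (jrad Λ P).mkQ) (Submodule.mkQ_surjective _)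
  refine ⟨f, ?_, ?_⟩
  · rw [← LinearMap.range_eq_top]
    apply aux_nak
    rw [eq_top_iff]
    intro y _
    obtain ⟨x, hx⟩ := (e.surjective.comp (Submodule.mkQ_surjective _)) ((jrad Λ N).mkQ y)
    have h1 : (jrad Λ N).mkQ (f x) = (jrad Λ N).mkQ y := by
      rw [← hx]; exact LinearMap.congr_fun hf x
    have h2 : y - f x ∈ jrad Λ N := by
      rw [← Submodule.ker_mkQ (jrad Λ N), LinearMap.mem_ker, map_sub, h1, sub_self]
    have : y = f x + (y - f x) := by abel
    rw [this]
    exact Submodule.add_mem_sup ⟨x, rfl⟩ h2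
  · intro x hx
    have h1 := LinearMap.congr_fun hf x
    simp only [LinearMap.comp_apply, LinearMap.mem_ker.1 hx, map_zero] at h1
    have h2 : (jrad Λ P).mkQ x = 0 := by
      apply e.injective
      rw [map_zero]; exact h1.symm
    rwa [← LinearMap.mem_ker, Submodule.ker_mkQ] at h2

/-- Lifting an isomorphism of quotients to an automorphism of `P`. -/
theorem aux_auto {P M N : Type} [AddCommGroup P] [Module Λ P] [AddCommGroup N] [Module Λ N]
    [AddCommGroup M] [Module Λ M] [Module.Finite Λ P] [IsNoetherian Λ P]
    (hP : Module.Projective Λ P)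
    (p : P →ₗ[Λ] M) (q : P →ₗ[Λ] N) (hp : Function.Surjective p) (hq : Function.Surjective q)
    (hk : LinearMap.ker p ≤ jrad Λ P)
    (e : N ≃ₗ[Λ] M) :
    ∃ h : P ≃ₗ[Λ] P, ∀ x, h x ∈ LinearMap.ker p ↔ x ∈ LinearMap.ker q := by
  obtain ⟨h, hh⟩ := Module.projective_lifting_property p (e.toLinearMap ∘ₗ q) hp
  have hs : Function.Surjective h := by
    rw [← LinearMap.range_eq_top]
    apply aux_nak
    rw [eq_top_iff]
    intro y _
    obtain ⟨x, hx⟩ := (e.surjective.comp hq) (p y)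
    have h1 : p (h x) = p y := by
      rw [← hx]; exact LinearMap.congr_fun hh x
    have h2 : y - h x ∈ jrad Λ P := by
      apply hk
      rw [LinearMap.mem_ker, map_sub, h1, sub_self]
    have : y = h x + (y - h x) := by abel
    rw [this]
    exact Submodule.add_mem_sup ⟨x, rfl⟩ h2
  have hi : Function.Injective h := by
    exact IsNoetherian.injective_of_surjective_endomorphism h hs
  have hb : Function.Bijective h := ⟨hi, hs⟩
  refine ⟨LinearEquiv.ofBijective h hb, fun x => ?_⟩
  have h1 := LinearMap.congr_fun hh x
  simp only [LinearMap.comp_apply] at h1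
  rw [LinearEquiv.ofBijective_apply, LinearMap.mem_ker, LinearMap.mem_ker, h1]
  exact e.map_eq_zero_iff

end Aux1

section Aux2

variable {K Λ : Type} [Field K] [IsAlgClosed K] [Ring Λ] [Algebra K Λ]

/-- endomorphisms of a squarefree semisimple module commute. -/
theorem aux_comm (T : Type) [AddCommGroup T] [Module Λ T] [Module K T] [IsScalarTower K Λ T]
    [FiniteDimensional K T]
    (hss : IsSemisimpleModule Λ T)
    (hsf : ∀ S S' : Submodule Λ T, IsSimpleModule Λ ↥S → IsSimpleModule Λ ↥S' →
        Nonempty (↥S ≃ₗ[Λ] ↥S') → S = S') (x y : T →ₗ[Λ] T) (v : T) : x (y v) = y (x v) := by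
  have key : ∀ S : Submodule Λ T, IsSimpleModule Λ S → ∀ z : T →ₗ[Λ] T,
      ∃ μ : K, ∀ s ∈ S, z s = μ • s := by
    intro S hS z
    have hinv : ∀ s ∈ S, z s ∈ S := by
      intro s hs
      by_cases h0 : z ∘ₗ S.subtype = 0
      · have := LinearMap.congr_fun h0 ⟨s, hs⟩
        simp at this
        rw [this]; exact S.zero_mem
      · have hinj := LinearMap.injective_of_ne_zero h0
        have e := LinearEquiv.ofInjective _ hinj
        have hS' : IsSimpleModule Λ (LinearMap.range (z ∘ₗ S.subtype)) :=
          IsSimpleModule.congr e.symm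
        have h1 := hsf _ _ hS hS' ⟨e⟩
        rw [h1]
        exact ⟨⟨s, hs⟩, rfl⟩
    let w : Module.End Λ S := z.restrict hinv
    have : FiniteDimensional K S :=
      inferInstanceAs (FiniteDimensional K (S.restrictScalars K))
    have : Nontrivial S := IsSimpleModule.nontrivial Λ S
    obtain ⟨μ, hμ⟩ := Module.End.exists_eigenvalue (w.restrictScalars K : Module.End K S)
    obtain ⟨s0, hs0⟩ := hμ.exists_hasEigenvector
    refine ⟨μ, ?_⟩
    have hz : w - μ • LinearMap.id = 0 := by
      by_contra h0
      have hinj := LinearMap.injective_of_ne_zero h0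
      apply hs0.2
      apply hinj
      have := hs0.apply_eq_smul
      simp only [LinearMap.coe_restrictScalars] at this
      simp [this]
    intro s hs
    have := LinearMap.congr_fun hz ⟨s, hs⟩
    simp [sub_eq_zero] at this
    have := congrArg Subtype.val this
    simpa [w] using this
  have htop : v ∈ sSup {m : Submodule Λ T | IsSimpleModule Λ m} := by
    rw [IsSemisimpleModule.sSup_simples_eq_top]; trivial
  have hle : sSup {m : Submodule Λ T | IsSimpleModule Λ m} ≤
      LinearMap.eqLocus (x ∘ₗ y) (y ∘ₗ x) := by
    refine sSup_le ?_
    intro S hS s hs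
    obtain ⟨a, ha⟩ := key S hS x
    obtain ⟨c, hc⟩ := key S hS y
    have hxs : x s ∈ S := by rw [ha s hs]; exact Submodule.smul_of_tower_mem S a hs
    have hys : y s ∈ S := by rw [hc s hs]; exact Submodule.smul_of_tower_mem S c hs
    rw [LinearMap.mem_eqLocus, LinearMap.comp_apply, LinearMap.comp_apply, hc _ hxs, ha _ hys,
      ha s hs, hc s hs, smul_comm]
  exact hle htop

end Aux2

section Aux3

open Polynomial in
/-- functions on the line, regular near `0`. -/
def AuxReg {K : Type} [Field K] (h : K → K) : Prop :=
  ∃ a q : K[X], q.eval 0 ≠ 0 ∧ ∀ t, h t * q.eval t = a.eval t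

variable {K : Type} [Field K]

theorem auxReg_poly (a : Polynomial K) : AuxReg (fun t => a.eval t) :=
  ⟨a, 1, by simp, by simp⟩

theorem auxReg_const (c : K) : AuxReg (fun _ => c) :=
  ⟨Polynomial.C c, 1, by simp, by simp⟩

theorem auxReg_add {h k : K → K} (hh : AuxReg h) (hk : AuxReg k) :
    AuxReg (fun t => h t + k t) := by
  obtain ⟨a, q, hq, h1⟩ := hh
  obtain ⟨a', q', hq', h2⟩ := hk
  refine ⟨a * q' + a' * q, q * q', by simp [hq, hq'], fun t => ?_⟩
  simp only [Polynomial.eval_add, Polynomial.eval_mul, ← h1, ← h2]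
  ring

theorem auxReg_mul {h k : K → K} (hh : AuxReg h) (hk : AuxReg k) :
    AuxReg (fun t => h t * k t) := by
  obtain ⟨a, q, hq, h1⟩ := hh
  obtain ⟨a', q', hq', h2⟩ := hk
  refine ⟨a * a', q * q', by simp [hq, hq'], fun t => ?_⟩
  simp only [Polynomial.eval_mul, ← h1, ← h2]
  ring

theorem auxReg_sum {α : Type} (s : Finset α) (h : α → K → K) (hh : ∀ i, AuxReg (h i)) :
    AuxReg (fun t => ∑ i ∈ s, h i t) := by
  classical
  induction s using Finset.induction_on with
  | empty => simpa using auxReg_const 0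
  | insert a s ha ih =>
    simp only [Finset.sum_insert ha]
    exact auxReg_add (hh a) ih

theorem auxReg_mmul {l m n : Type} [Fintype m] {A : K → Matrix l m K} {B : K → Matrix m n K}
    (hA : ∀ i j, AuxReg (fun t => A t i j)) (hB : ∀ i j, AuxReg (fun t => B t i j)) (i : l) (j : n) :
    AuxReg (fun t => (A t * B t) i j) := by
  simp only [Matrix.mul_apply]
  exact auxReg_sum _ (fun k t => A t i k * B t k j) (fun k => auxReg_mul (hA i k) (hB k j))

theorem auxReg_mv {σ : Type} (p : MvPolynomial σ K) (x : K → σ → K)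
    (hx : ∀ i, AuxReg (fun t => x t i)) : AuxReg (fun t => MvPolynomial.eval (x t) p) := by
  induction p using MvPolynomial.induction_on with
  | C a => simpa using auxReg_const a
  | add p q hp hq => simpa using auxReg_add hp hq
  | mul_X p i hp => simpa using auxReg_mul hp (hx i)

theorem auxReg_zero [Infinite K] {h : K → K} (hh : AuxReg h) (S : Set K) (hS : S.Finite)
    (h0 : ∀ t, t ∉ S → h t = 0) : h 0 = 0 := by
  obtain ⟨a, q, hq, h1⟩ := hh
  have ha : a = 0 := by
    apply Polynomial.eq_zero_of_infinite_isRoot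
    refine Set.Infinite.mono ?_ (hS.infinite_compl)
    intro t ht
    show a.eval t = 0
    rw [← h1, h0 t ht, zero_mul]
  have := h1 0
  rw [ha, Polynomial.eval_zero] at this
  exact (mul_eq_zero.1 this).resolve_right hq

/-- `det (1 + t B)` as a polynomial. -/
theorem aux_lin_eval {n : ℕ} (B : Matrix (Fin n) (Fin n) K) (t : K) :
    (1 + (Polynomial.X : Polynomial K) • B.map Polynomial.C).map (Polynomial.eval t) = 1 + t • B := by
  ext i j
  by_cases h : i = j <;> simp [h] <;> ring

theorem aux_det_eval {n : ℕ} (B : Matrix (Fin n) (Fin n) K) (t : K) :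
    (1 + (Polynomial.X : Polynomial K) • B.map Polynomial.C).det.eval t = (1 + t • B).det := by
  rw [← aux_lin_eval B t]
  exact (RingHom.map_det (Polynomial.evalRingHom t) _)

theorem aux_adj_eval {n : ℕ} (B : Matrix (Fin n) (Fin n) K) (t : K) (i j : Fin n) :
    ((1 + (Polynomial.X : Polynomial K) • B.map Polynomial.C).adjugate i j).eval t
      = (1 + t • B).adjugate i j := by
  rw [← aux_lin_eval B t]
  have := RingHom.map_adjugate (Polynomial.evalRingHom t)
    (1 + (Polynomial.X : Polynomial K) • B.map Polynomial.C)
  exact congrFun (congrFun this i) j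

theorem auxReg_inv {n : ℕ} (B : Matrix (Fin n) (Fin n) K) (i j : Fin n) :
    AuxReg (fun t => ((1 + t • B)⁻¹ : Matrix (Fin n) (Fin n) K) i j) := by
  let D := (1 + (Polynomial.X : Polynomial K) • B.map Polynomial.C)
  refine ⟨D.adjugate i j * D.det, D.det * D.det, ?_, fun t => ?_⟩
  · simp [D, aux_det_eval]
  · simp only [Polynomial.eval_mul, D, aux_det_eval, aux_adj_eval, Matrix.inv_def,
      Matrix.smul_apply, smul_eq_mul, Ring.inverse_eq_inv']
    by_cases h : (1 + t • B).det = 0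
    · simp [h]
    · field_simp

theorem aux_deg {Λ ι : Type} [Infinite K] [Ring Λ] [Algebra K Λ] [Fintype ι]
    (b : Basis ι K Λ) (d : ℕ) (ρ τ : Λ →ₐ[K] Matrix (Fin d) (Fin d) K)
    (X : K → ι → Matrix (Fin d) (Fin d) K) (hX : ∀ k i j, AuxReg (fun t => X t k i j))
    (h0 : ∀ k, X 0 k = τ (b k)) (S : Set K) (hS : S.Finite)
    (h1 : ∀ t, t ∉ S → ∃ g : GL (Fin d) K, ∀ k, X t k = (g : Matrix (Fin d) (Fin d) K) * ρ (b k) *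
            ((g⁻¹ : GL (Fin d) K) : Matrix (Fin d) (Fin d) K)) : IsDegeneration b d ρ τ := by
  intro p hp
  have := auxReg_zero (auxReg_mv p (fun t (x : ι × Fin d × Fin d) => X t x.1 x.2.1 x.2.2)
    (fun x => hX _ _ _)) S hS (by
      intro t ht
      obtain ⟨g, hg⟩ := h1 t ht
      simp only [hg]
      exact hp g)
  simpa only [h0] using this

theorem aux_family {Λ ι : Type} [Infinite K] [Ring Λ] [Algebra K Λ] [Fintype ι]
    (b : Basis ι K Λ) (d : ℕ) (ρ τ : Λ →ₐ[K] Matrix (Fin d) (Fin d) K)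
    (P : Type) [AddCommGroup P] [Module Λ P] [Module K P] [IsScalarTower K Λ P]
    [FiniteDimensional K P] (p q : P →ₗ[K] (Fin d → K))
    (hp : ∀ (a : Λ) x, p (a • x) = (ρ a).mulVec (p x))
    (hq : ∀ (a : Λ) x, q (a • x) = (τ a).mulVec (q x))
    (hqs : Function.Surjective q) (B : P →ₗ[K] P)
    (S : Set K) (hS : S.Finite)
    (h1 : ∀ t, t ∉ S → ∃ v : P →ₗ[Λ] P, ∀ x, p (v (x + t • B x)) = 0 ↔ q x = 0) :
    IsDegeneration b d ρ τ := by
  classical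
  let β := Module.finBasis K P
  let ε := Pi.basisFun K (Fin d)
  obtain ⟨s, hs⟩ := LinearMap.exists_rightInverse_of_surjective q (LinearMap.range_eq_top.2 hqs)
  let mB := LinearMap.toMatrix β β B
  let A : K → Matrix _ _ K := fun t => 1 + t • mB
  let mQ := LinearMap.toMatrix β ε q
  let mP := LinearMap.toMatrix β ε p
  let mS := LinearMap.toMatrix ε β s
  let L : Λ → (P →ₗ[K] P) := fun a => (Algebra.lsmul K K P a)
  let mL : Λ → Matrix _ _ K := fun a => LinearMap.toMatrix β β (L a)
  have hA : ∀ t, A t = LinearMap.toMatrix β β (LinearMap.id + t • B) := by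
    intro t
    simp [A, mB]
  have hε : ∀ M : Matrix (Fin d) (Fin d) K, LinearMap.toMatrix ε ε (Matrix.toLin' M) = M := by
    intro M
    exact LinearMap.toMatrix'_toLin' M
  have hrho : ∀ a, ρ a * mP = mP * mL a := by
    intro a
    rw [← hε (ρ a)]
    simp only [mP, mL]
    rw [← LinearMap.toMatrix_comp, ← LinearMap.toMatrix_comp]
    congr 1
    ext1 x
    simp [L, hp]
  have htau : ∀ a, τ a * mQ = mQ * mL a := by
    intro a
    rw [← hε (τ a)]
    simp only [mQ, mL]
    rw [← LinearMap.toMatrix_comp, ← LinearMap.toMatrix_comp]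
    congr 1
    ext1 x
    simp [L, hq]
  have hQS : mQ * mS = 1 := by
    simp only [mQ, mS]
    rw [← LinearMap.toMatrix_comp, hs, LinearMap.toMatrix_id]
  have hdfin : {t : K | (A t).det = 0}.Finite := by
    have := Polynomial.finite_setOfPred_isRoot
      (p := (1 + (Polynomial.X : Polynomial K) • mB.map Polynomial.C).det) (by
        intro h
        have := aux_det_eval mB 0
        rw [h] at this
        simp at this)
    refine this.subset ?_
    intro t ht
    show Polynomial.eval t _ = 0
    rw [aux_det_eval]
    exact ht
  refine aux_deg b d ρ τ (fun t k => mQ * (A t)⁻¹ * mL (b k) * A t * mS) ?_ ?_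
    (S ∪ {t : K | (A t).det = 0}) (hS.union hdfin) ?_
  · intro k
    have hAr : ∀ i j, AuxReg (fun t => A t i j) := by
      intro i j
      have := auxReg_poly ((1 + (Polynomial.X : Polynomial K) • mB.map Polynomial.C) i j)
      have h2 : ∀ t, Polynomial.eval t ((1 + (Polynomial.X : Polynomial K) • mB.map Polynomial.C) i j)
          = A t i j := fun t => congrFun (congrFun (aux_lin_eval mB t) i) j
      simpa only [h2] using this
    have hc : ∀ {l m : Type} (M : Matrix l m K) i j, AuxReg (fun _ : K => M i j) :=
      fun M i j => auxReg_const _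
    exact auxReg_mmul (auxReg_mmul (auxReg_mmul (auxReg_mmul (hc _) (auxReg_inv mB)) (hc _)) hAr) (hc _)
  · intro k
    simp only [A, zero_smul, add_zero, inv_one, Matrix.mul_one]
    rw [← htau, Matrix.mul_assoc, hQS, mul_one]
  · intro t ht
    rw [Set.mem_union, not_or] at ht
    obtain ⟨v, hv⟩ := h1 t ht.1
    have hdet : IsUnit (A t).det := isUnit_iff_ne_zero.2 ht.2
    let vK : P →ₗ[K] P := v.restrictScalars K
    let mV := LinearMap.toMatrix β β vK
    let Gl : (Fin d → K) →ₗ[K] (Fin d → K) := p ∘ₗ vK ∘ₗ (LinearMap.id + t • B) ∘ₗ s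
    have hG : LinearMap.toMatrix ε ε Gl = mP * mV * A t * mS := by
      simp only [Gl, mP, mV, hA, mS]
      rw [LinearMap.toMatrix_comp ε β ε, LinearMap.toMatrix_comp ε β β,
        LinearMap.toMatrix_comp ε β β]
      simp only [Matrix.mul_assoc]
    have hGi : Function.Injective Gl := by
      rw [← LinearMap.ker_eq_bot, LinearMap.ker_eq_bot']
      intro y hy
      have h2 : q (s y) = 0 := (hv (s y)).1 hy
      have h3 := LinearMap.congr_fun hs y
      simp only [LinearMap.comp_apply, LinearMap.id_apply] at h3
      rw [← h3, h2]
    have hGu : IsUnit (mP * mV * A t * mS) := by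
      rw [← hG]
      have : IsUnit Gl := by
        rw [Module.End.isUnit_iff]
        exact ⟨hGi, LinearMap.injective_iff_surjective.1 hGi⟩
      exact this.map (LinearMap.toMatrixAlgEquiv ε)
    obtain ⟨G, hGG⟩ := hGu
    have hVL : ∀ a, mV * mL a = mL a * mV := by
      intro a
      simp only [mV, mL]
      rw [← LinearMap.toMatrix_comp, ← LinearMap.toMatrix_comp]
      congr 1
      ext1 x
      simp [L, vK]
    have hkill : mP * mV * A t * mS * mQ = mP * mV * A t := by
      simp only [mP, mV, hA, mS, mQ]
      rw [← LinearMap.toMatrix_comp β β ε, ← LinearMap.toMatrix_comp β β ε,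
        ← LinearMap.toMatrix_comp ε β ε, ← LinearMap.toMatrix_comp β ε ε]
      congr 1
      ext1 x
      have h2 : q (s (q x) - x) = 0 := by
        have h3 := LinearMap.congr_fun hs (q x)
        simp only [LinearMap.comp_apply, LinearMap.id_apply] at h3
        rw [map_sub, h3, sub_self]
      have h3 := (hv _).2 h2
      rw [← sub_eq_zero, ← h3]
      simp only [LinearMap.comp_apply, LinearMap.add_apply, LinearMap.id_apply,
        LinearMap.smul_apply, vK, LinearMap.coe_restrictScalars]
      rw [← map_sub, ← map_sub]
      congr 2
      rw [map_sub, smul_sub]; abel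
    refine ⟨G⁻¹, fun k => ?_⟩
    have hmain : (G : Matrix (Fin d) (Fin d) K) * (mQ * (A t)⁻¹ * mL (b k) * A t * mS)
        = ρ (b k) * (G : Matrix (Fin d) (Fin d) K) := by
      rw [hGG]
      calc mP * mV * A t * mS * (mQ * (A t)⁻¹ * mL (b k) * A t * mS)
          = (mP * mV * A t * mS * mQ) * ((A t)⁻¹ * mL (b k) * A t * mS) := by
            simp only [Matrix.mul_assoc]
        _ = mP * mV * (A t * (A t)⁻¹) * (mL (b k) * A t * mS) := by
            rw [hkill]; simp only [Matrix.mul_assoc]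
        _ = mP * (mV * mL (b k)) * A t * mS := by
            rw [Matrix.mul_nonsing_inv _ hdet]; simp only [Matrix.mul_assoc, Matrix.mul_one]
        _ = (mP * mL (b k)) * mV * A t * mS := by
            rw [hVL]; simp only [Matrix.mul_assoc]
        _ = _ := by rw [← hrho]; simp only [Matrix.mul_assoc]
    rw [inv_inv, mul_assoc, ← hmain, ← mul_assoc, Units.inv_mul, one_mul]

end Aux3

section Aux4

variable {K : Type} [Field K]

theorem aux_eig [IsAlgClosed K] {E : Type} [AddCommGroup E] [Module K E] [FiniteDimensional K E]
    (Op : Set (E →ₗ[K] E)) (I V : Submodule K E)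
    (hI : ∀ s ∈ Op, ∀ x ∈ I, s x ∈ I) (hV : ∀ s ∈ Op, ∀ x ∈ V, s x ∈ V)
    (hc : ∀ s ∈ Op, ∀ t ∈ Op, ∀ v ∈ V, s (t v) - t (s v) ∈ I)
    (hne : ∃ v ∈ V, v ∉ I) :
    ∃ f ∈ V, f ∉ I ∧ ∀ s ∈ Op, ∃ μ : K, s f - μ • f ∈ I := by
  let Z : Set (Submodule K E) := {U | U ≤ V ∧ (∀ s ∈ Op, ∀ x ∈ U, s x ∈ U) ∧ ∃ v ∈ U, v ∉ I}
  have hZ : Z.Nonempty := ⟨V, le_rfl, hV, hne⟩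
  obtain ⟨U, ⟨hUV, hU, v, hvU, hvI⟩, hmin⟩ :=
    (wellFounded_lt : WellFounded ((· < ·) : Submodule K E → Submodule K E → Prop)).has_min Z hZ
  refine ⟨v, hUV hvU, hvI, fun s hs => ?_⟩
  let I' := I.comap U.subtype
  let sU : U →ₗ[K] U := s.restrict (hU s hs)
  have hI' : I' ≤ I'.comap sU := by
    intro x hx
    exact hI s hs _ hx
  let sQ : Module.End K (U ⧸ I') := I'.mapQ I' sU hI'
  have : Nontrivial (U ⧸ I') := by
    refine ⟨I'.mkQ ⟨v, hvU⟩, 0, ?_⟩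
    intro h
    rw [← LinearMap.mem_ker, Submodule.ker_mkQ] at h
    exact hvI h
  obtain ⟨μ, hμ⟩ := Module.End.exists_eigenvalue sQ
  obtain ⟨w, hw⟩ := hμ.exists_hasEigenvector
  obtain ⟨u, rfl⟩ := I'.mkQ_surjective w
  have hu1 : s u - μ • (u : E) ∈ I := by
    have h1 := hw.apply_eq_smul
    have h2 : I'.mkQ (sU u - μ • u) = 0 := by
      rw [map_sub, map_smul, ← h1, sub_eq_zero]
      rfl
    rw [← LinearMap.mem_ker, Submodule.ker_mkQ] at h2
    exact h2
  have hu2 : (u : E) ∉ I := by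
    intro h
    apply hw.2
    rw [← LinearMap.mem_ker, Submodule.ker_mkQ]
    exact h
  let U' : Submodule K E := U ⊓ I.comap (s - μ • LinearMap.id)
  have hmem : ∀ x, x ∈ U' ↔ x ∈ U ∧ s x - μ • x ∈ I := by
    intro x
    simp [U']
  have hU'Z : U' ∈ Z := by
    refine ⟨inf_le_left.trans hUV, ?_, u, (hmem _).2 ⟨u.2, hu1⟩, hu2⟩
    intro t ht x hx
    rw [hmem] at hx ⊢
    refine ⟨hU t ht x hx.1, ?_⟩
    have h1 := hc s hs t ht x (hUV hx.1)
    have h2 := hI t ht _ hx.2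
    have h3 := I.add_mem h1 h2
    rw [map_sub, map_smul] at h3
    convert h3 using 1
    abel
  have hle : U' ≤ U := inf_le_left
  have heq : U' = U := by
    by_contra h
    exact hmin U' hU'Z (lt_of_le_of_ne hle h)
  rw [← heq, hmem] at hvU
  exact ⟨μ, hvU.2⟩

variable {Λ : Type} [Ring Λ] [Algebra K Λ]

theorem aux_step {P : Type} [AddCommGroup P] [Module Λ P] [Module K P] [IsScalarTower K Λ P]
    [FiniteDimensional K P] (I : Submodule K (Module.End Λ P))
    (hl : ∀ x, ∀ g ∈ I, x * g ∈ I)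
    (C : Submodule Λ P) (hC : ∀ x ∈ I, ∀ c ∈ C, x c ∈ C) (f : Module.End Λ P) (l : K)
    (hf : f * f - l • f ∈ I) :
    ∃ C0 : Submodule Λ P, C0 = (C ⊓ C.comap f) ⊔ C.map f ∧ (∀ x ∈ C0, f x ∈ C0) ∧
      finrank K C0 = finrank K C ∧
      ∃ B : P →ₗ[K] P, ∃ S : Set K, S.Finite ∧ ∀ t, t ∉ S → ∃ v : P →ₗ[Λ] P,
        ∀ x, v (x + t • B x) ∈ C ↔ x ∈ C0 := by
  have hff : ∀ x, ∃ g ∈ I, f (f x) = l • f x + g x := by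
    intro x
    refine ⟨_, hf, ?_⟩
    simp
  let fK : P →ₗ[K] P := f.restrictScalars K
  let DL : Submodule Λ P := C ⊓ C.comap f
  have hDL : ∀ x, x ∈ DL ↔ x ∈ C ∧ f x ∈ C := fun x => Iff.rfl
  let D : Submodule K P := DL.restrictScalars K
  have hCl : ∀ (a : K) {x : P}, x ∈ C → a • x ∈ C := fun a x hx => Submodule.smul_of_tower_mem C a hx
  have hfC : ∀ x ∈ DL, f x ∈ DL := by
    intro x hx
    rw [hDL] at hx ⊢
    refine ⟨hx.2, ?_⟩
    obtain ⟨g, hg, h⟩ := hff x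
    rw [h]
    exact C.add_mem (hCl _ hx.2) (hC g hg x hx.1)
  obtain ⟨E', hE'⟩ := Submodule.exists_isCompl D
  let E : Submodule K P := E' ⊓ C.restrictScalars K
  have hEC : ∀ x ∈ E, x ∈ C := fun x hx => hx.2
  have hED : ∀ x ∈ E, x ∈ DL → x = 0 := by
    intro x hx hx'
    exact (Submodule.disjoint_def.1 hE'.disjoint) x hx' hx.1
  have hdec : ∀ c ∈ C, ∃ y ∈ DL, ∃ e ∈ E, c = y + e := by
    intro c hc
    have : c ∈ D ⊔ E' := by rw [hE'.sup_eq_top]; trivial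
    obtain ⟨y, hy, e, he, rfl⟩ := Submodule.mem_sup.1 this
    refine ⟨y, hy, e, ⟨he, ?_⟩, rfl⟩
    have hyC : y ∈ C := ((hDL y).1 hy).1
    exact (Submodule.add_mem_iff_right C hyC).1 hc
  let φ : (D × E) →ₗ[K] P := D.subtype.coprod (fK ∘ₗ E.subtype)
  let ψ : (D × E) →ₗ[K] P := D.subtype.coprod (E.subtype)
  have hφ : ∀ x, φ x = (x.1 : P) + f x.2 := fun x => by simp [φ, fK]
  have hψ : ∀ x, ψ x = (x.1 : P) + x.2 := fun x => by simp [ψ]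
  have hφi : Function.Injective φ := by
    rw [← LinearMap.ker_eq_bot, LinearMap.ker_eq_bot']
    rintro ⟨y, e⟩ h
    rw [hφ] at h
    simp only at h
    have hy : (y : P) ∈ DL := y.2
    have h1 : f e ∈ C := by
      have : f e = - (y : P) := by rw [eq_neg_iff_add_eq_zero, add_comm]; exact h
      rw [this]
      exact C.neg_mem ((hDL _).1 hy).1
    have h2 : (e : P) = 0 := hED _ e.2 ((hDL _).2 ⟨hEC _ e.2, h1⟩)
    rw [h2, map_zero, add_zero] at h
    ext
    · exact h
    · exact h2
  have hψi : Function.Injective ψ := by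
    rw [← LinearMap.ker_eq_bot, LinearMap.ker_eq_bot']
    rintro ⟨y, e⟩ h
    rw [hψ] at h
    simp only at h
    have hy : (y : P) ∈ DL := y.2
    have h2 : (e : P) = 0 := by
      apply hED _ e.2
      have : (e : P) = - (y : P) := by rw [eq_neg_iff_add_eq_zero, add_comm]; exact h
      rw [this]
      exact DL.neg_mem hy
    rw [h2, add_zero] at h
    ext
    · exact h
    · exact h2
  let C0 : Submodule Λ P := DL ⊔ C.map f
  have hφr : LinearMap.range φ = C0.restrictScalars K := by
    ext x
    constructor
    · rintro ⟨⟨y, e⟩, rfl⟩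
      rw [hφ]
      exact Submodule.add_mem_sup y.2 ⟨e, hEC _ e.2, rfl⟩
    · intro hx
      obtain ⟨y, hy, z, ⟨c, hc, rfl⟩, rfl⟩ := Submodule.mem_sup.1 hx
      obtain ⟨y', hy', e, he, rfl⟩ := hdec c hc
      refine ⟨(⟨y + f y', DL.add_mem hy (hfC _ hy')⟩, ⟨e, he⟩), ?_⟩
      rw [hφ]
      simp only [map_add]
      abel
  have hψr : LinearMap.range ψ = C.restrictScalars K := by
    ext x
    constructor
    · rintro ⟨⟨y, e⟩, rfl⟩
      rw [hψ]
      exact C.add_mem ((hDL _).1 y.2).1 (hEC _ e.2)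
    · intro hx
      obtain ⟨y', hy', e, he, rfl⟩ := hdec x hx
      exact ⟨(⟨y', hy'⟩, ⟨e, he⟩), by rw [hψ]⟩
  have hfr : finrank K C0 = finrank K C := by
    have h1 := LinearMap.finrank_range_of_inj hφi
    have h2 := LinearMap.finrank_range_of_inj hψi
    rw [hφr] at h1
    rw [hψr] at h2
    exact h1.trans h2.symm
  obtain ⟨r, hr⟩ := LinearMap.exists_leftInverse_of_injective φ (LinearMap.ker_eq_bot.2 hφi)
  let B : P →ₗ[K] P := E.subtype ∘ₗ LinearMap.snd K D E ∘ₗ r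
  have hB : ∀ x, B (φ x) = x.2 := by
    intro x
    have := LinearMap.congr_fun hr x
    simp only [LinearMap.comp_apply, LinearMap.id_apply] at this
    simp [B, this]
  refine ⟨C0, rfl, ?_, hfr, B, {0, -l} ∪ ((fun t : K => -t) ⁻¹' {μ | Module.End.HasEigenvalue fK μ} ∪
    (fun t : K => -t⁻¹) ⁻¹' {μ | Module.End.HasEigenvalue B μ}), ?_, ?_⟩
  · intro x hx
    obtain ⟨y, hy, z, ⟨c, hc, rfl⟩, rfl⟩ := Submodule.mem_sup.1 hx
    rw [map_add]
    refine C0.add_mem (Submodule.mem_sup_left (hfC _ hy)) ?_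
    obtain ⟨g, hg, h⟩ := hff c
    show f (f c) ∈ C0
    rw [h]
    refine C0.add_mem (Submodule.smul_of_tower_mem C0 l (Submodule.mem_sup_right ⟨c, hc, rfl⟩))
      (Submodule.mem_sup_left ((hDL _).2 ⟨hC g hg c hc, hC _ (hl f g hg) c hc⟩))
  · refine Set.Finite.union (by simp) (Set.Finite.union ?_ ?_)
    · exact Set.Finite.preimage (neg_injective.injOn) (Module.End.finite_hasEigenvalue fK)
    · exact Set.Finite.preimage ((neg_injective.comp inv_injective).injOn)
        (Module.End.finite_hasEigenvalue B)
  · intro t ht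
    simp only [Set.mem_union, Set.mem_insert_iff, Set.mem_singleton_iff, Set.mem_preimage,
      Set.mem_ofPred_eq, not_or] at ht
    obtain ⟨⟨ht0, htl⟩, htf, htB⟩ := ht
    have htl' : t + l ≠ 0 := fun h => htl (eq_neg_of_add_eq_zero_left h)
    let u : P →ₗ[Λ] P := t • LinearMap.id + f
    have hu : ∀ x, u x = t • x + f x := fun x => by simp [u]
    have hui : Function.Injective u := by
      rw [← LinearMap.ker_eq_bot, LinearMap.ker_eq_bot']
      intro x hx
      by_contra hx0
      apply htf
      apply Module.End.hasEigenvalue_of_hasEigenvector (x := x)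
      refine ⟨Module.End.mem_eigenspace_iff.2 ?_, hx0⟩
      rw [hu] at hx
      rw [neg_smul]
      exact eq_neg_of_add_eq_zero_right hx
    have hus : Function.Surjective u :=
      (LinearMap.injective_iff_surjective (f := u.restrictScalars K)).1 hui
    have hub : Function.Bijective u := ⟨hui, hus⟩
    let ue : P ≃ₗ[Λ] P := LinearEquiv.ofBijective u hub
    have huv : ∀ x, u (ue.symm x) = x := fun x => ue.apply_symm_apply x
    have hvu : ∀ x, ue.symm (u x) = x := fun x => ue.symm_apply_apply x
    let v : P →ₗ[Λ] P := ue.symm.toLinearMap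
    have hv : ∀ x, v x = ue.symm x := fun x => rfl
    refine ⟨v, ?_⟩
    let w : P →ₗ[K] P := v.restrictScalars K ∘ₗ (LinearMap.id + t • B)
    have hw : ∀ x, w x = v (x + t • B x) := fun x => by simp [w]
    have hwi : Function.Injective w := by
      rw [← LinearMap.ker_eq_bot, LinearMap.ker_eq_bot']
      intro x hx
      rw [hw, hv, LinearEquiv.map_eq_zero_iff] at hx
      by_contra hx0
      apply htB
      apply Module.End.hasEigenvalue_of_hasEigenvector (x := x)
      refine ⟨Module.End.mem_eigenspace_iff.2 ?_, hx0⟩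
      have h2 : t • B x = - x := eq_neg_of_add_eq_zero_right hx
      have h3 : B x = t⁻¹ • (t • B x) := by rw [smul_smul, inv_mul_cancel₀ ht0, one_smul]
      rw [h3, h2, smul_neg, neg_smul]
    have hvD : ∀ y ∈ DL, v y ∈ C := by
      intro y hy
      have hy' := (hDL y).1 hy
      obtain ⟨g, hg, h⟩ := hff y
      have h1 : u ((t + l) • y - f y) = (t * (t + l)) • y - g y := by
        rw [hu, map_sub, h, LinearMap.map_smul_of_tower]
        module
      have h2 : (t * (t + l)) • v y = ((t + l) • y - f y) + v (g y) := by
        have := congrArg v h1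
        rw [hv, hvu, map_sub, LinearMap.map_smul_of_tower] at this
        rw [this]; abel
      have h3 : v y = (t * (t + l))⁻¹ • ((t * (t + l)) • v y) := by
        rw [smul_smul, inv_mul_cancel₀ (mul_ne_zero ht0 htl'), one_smul]
      rw [h3, h2]
      refine hCl _ (C.add_mem (C.sub_mem (hCl _ hy'.1) hy'.2) ?_)
      exact hC _ (hl v g hg) y hy'.1
    have hmap : ∀ x ∈ C0, w x ∈ C := by
      intro x hx
      have : x ∈ LinearMap.range φ := by rw [hφr]; exact hx
      obtain ⟨⟨y, e⟩, rfl⟩ := this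
      rw [hw, hB, hφ]
      simp only
      have h1 : (y : P) + f e + t • (e : P) = y + u e := by rw [hu]; abel
      rw [h1, map_add, hv (u e), hvu]
      exact C.add_mem (hvD _ y.2) (hEC _ e.2)
    have heq : (C0.restrictScalars K).map w = C.restrictScalars K := by
      apply Submodule.eq_of_le_of_finrank_eq
      · rintro _ ⟨x, hx, rfl⟩
        exact hmap x hx
      · rw [← (Submodule.equivMapOfInjective w hwi (C0.restrictScalars K)).finrank_eq]
        exact hfr
    intro x
    rw [← hw]
    constructor
    · intro hx
      have : w x ∈ (C0.restrictScalars K).map w := by rw [heq]; exact hx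
      obtain ⟨y, hy, hyx⟩ := this
      rw [← hwi hyx]; exact hy
    · exact hmap x

end Aux4

section Aux5

variable {K Λ : Type} [Field K] [Ring Λ] [Algebra K Λ]

theorem aux_rep {P : Type} [AddCommGroup P] [Module Λ P] [Module K P] [IsScalarTower K Λ P]
    [FiniteDimensional K P] (C : Submodule Λ P) (d : ℕ) (hC : finrank K (P ⧸ C) = d) :
    ∃ (ρ : Λ →ₐ[K] Matrix (Fin d) (Fin d) K) (p : P →ₗ[Λ] RepSpace K d ρ),
      Function.Surjective p ∧ LinearMap.ker p = C := by
  have : FiniteDimensional K (P ⧸ C) :=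
    inferInstanceAs (FiniteDimensional K (P ⧸ C.restrictScalars K))
  let β : Basis (Fin d) K (P ⧸ C) := Module.finBasisOfFinrankEq K (P ⧸ C) hC
  let ρ : Λ →ₐ[K] Matrix (Fin d) (Fin d) K :=
    (LinearMap.toMatrixAlgEquiv β).toAlgHom.comp (Algebra.lsmul K K (P ⧸ C))
  let e : (P ⧸ C) ≃ₗ[K] (Fin d → K) := β.equivFun
  have he : ∀ (a : Λ) (x : P ⧸ C), e (a • x) = (ρ a).mulVec (e x) := by
    intro a x
    exact (LinearMap.toMatrix_mulVec_repr β β (Algebra.lsmul K K (P ⧸ C) a) x).symm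
  let p : P →ₗ[Λ] RepSpace K d ρ :=
    { toFun := fun x => e (C.mkQ x)
      map_add' := fun x y => by rw [map_add, map_add]; rfl
      map_smul' := fun a x => by rw [map_smul, he]; rfl }
  have hp : ∀ x, p x = e (C.mkQ x) := fun _ => rfl
  refine ⟨ρ, p, ?_, ?_⟩
  · exact e.surjective.comp C.mkQ_surjective
  · ext x
    rw [LinearMap.mem_ker, hp]
    have h0 : (0 : RepSpace K d ρ) = (0 : Fin d → K) := rfl
    rw [h0]
    have h1 : e (C.mkQ x) = 0 ↔ C.mkQ x = 0 := e.map_eq_zero_iff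
    refine h1.trans ?_
    rw [← LinearMap.mem_ker, Submodule.ker_mkQ]

theorem aux_comm_top [IsAlgClosed K]
    (T : Type) [AddCommGroup T] [Module Λ T] [Module K T] [IsScalarTower K Λ T]
    [FiniteDimensional K T]
    (P : Type) [AddCommGroup P] [Module Λ P]
    (hss : IsSemisimpleModule Λ T)
    (hsf : ∀ S S' : Submodule Λ T, IsSimpleModule Λ ↥S → IsSimpleModule Λ ↥S' →
        Nonempty (↥S ≃ₗ[Λ] ↥S') → S = S')
    (e : (P ⧸ jrad Λ P) ≃ₗ[Λ] T) (x y : P →ₗ[Λ] P) (v : P) :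
    x (y v) - y (x v) ∈ jrad Λ P := by
  have hle : ∀ z : P →ₗ[Λ] P, jrad Λ P ≤ (jrad Λ P).comap z := fun z =>
    Submodule.map_le_iff_le_comap.1 (aux_jrad_map_le z)
  let bar : (P →ₗ[Λ] P) → (T →ₗ[Λ] T) := fun z =>
    e.toLinearMap ∘ₗ (jrad Λ P).mapQ (jrad Λ P) z (hle z) ∘ₗ e.symm.toLinearMap
  have hbar : ∀ z w, bar z (e ((jrad Λ P).mkQ w)) = e ((jrad Λ P).mkQ (z w)) := by
    intro z w
    simp [bar]
  have h := aux_comm (K := K) T hss hsf (bar x) (bar y) (e ((jrad Λ P).mkQ v))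
  rw [hbar, hbar, hbar, hbar] at h
  have h2 := e.injective h
  rw [← Submodule.ker_mkQ (jrad Λ P), LinearMap.mem_ker, map_sub, h2, sub_self]

theorem aux_findf [IsAlgClosed K] [FiniteDimensional K Λ]
    {P : Type} [AddCommGroup P] [Module Λ P] [Module K P] [IsScalarTower K Λ P]
    [FiniteDimensional K P] (hcomm : ∀ (x y : P →ₗ[Λ] P) (v : P), x (y v) - y (x v) ∈ jrad Λ P)
    (I : Submodule K (Module.End Λ P))
    (hl : ∀ x, ∀ g ∈ I, x * g ∈ I) (hr : ∀ x, ∀ g ∈ I, g * x ∈ I) (hI : I ≠ ⊤) :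
    ∃ f, f ∉ I ∧ (∀ x, ∃ μ : K, x * f - μ • f ∈ I) ∧ (∀ x, ∃ μ : K, f * x - μ • f ∈ I) := by
  have hart : IsArtinianRing Λ := IsArtinianRing.of_finite K Λ
  obtain ⟨m, hm⟩ := IsArtinianRing.isNilpotent_jacobson_bot (R := Λ)
  have hfin : FiniteDimensional K (Module.End Λ P) :=
    Module.Finite.of_injective (LinearMap.restrictScalarsₗ K Λ P P K)
      (LinearMap.restrictScalars_injective K)
  let F : ℕ → Submodule Λ P := fun k => (jacRad Λ ^ k) • ⊤
  have hp0 : jacRad Λ ^ 0 = 1 := Submodule.pow_zero _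
  have hp2 : ∀ k, jacRad Λ ^ (k + 1) = jacRad Λ ^ k * jacRad Λ := fun k => Submodule.pow_succ _
  have hF0 : F 0 = ⊤ := by
    simp only [F]
    rw [hp0, Submodule.one_smul]
  have hFm : F m = ⊥ := by
    show (jacRad Λ ^ m) • (⊤ : Submodule Λ P) = ⊥
    rw [show jacRad Λ ^ m = ⊥ from hm, Submodule.bot_smul]
  have hFs : ∀ k, F (k + 1) = jacRad Λ • F k := by
    intro k
    simp only [F]
    rcases Nat.eq_zero_or_pos k with rfl | hk
    · rw [hp2, hp0, Submodule.mul_smul, Submodule.one_smul, Submodule.one_smul]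
    · rw [Submodule.pow_succ' _ hk.ne', Submodule.mul_smul]
  have hFs' : ∀ k, F (k + 1) = jacRad Λ ^ k • jrad Λ P := by
    intro k
    simp only [F]
    rw [hp2, Submodule.mul_smul, aux_jrad_eq]
  have hFmap : ∀ k (x : P →ₗ[Λ] P), ∀ y ∈ F k, x y ∈ F k := by
    intro k x y hy
    have h1 : (F k).map x ≤ F k := by
      simp only [F]
      rw [Submodule.map_smul'']
      exact smul_mono_right _ le_top
    exact h1 ⟨y, hy, rfl⟩
  have hex : ∃ k, ∀ v : Module.End Λ P, (∀ x, v x ∈ F k) → v ∈ I := by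
    refine ⟨m, fun v hv => ?_⟩
    have : v = 0 := by
      ext x
      have := hv x
      rw [hFm] at this
      simpa using this
    rw [this]; exact I.zero_mem
  classical
  obtain ⟨k, hk⟩ : ∃ k, Nat.find hex = k + 1 := by
    apply Nat.exists_eq_succ_of_ne_zero
    intro h0
    have := Nat.find_spec hex
    rw [h0] at this
    apply hI
    rw [eq_top_iff]
    intro v _
    apply this
    intro x
    rw [hF0]; trivial
  have hspec := Nat.find_spec hex
  rw [hk] at hspec
  have hnot := Nat.find_min hex (m := k) (by omega)
  push Not at hnot
  obtain ⟨v0, hv0, hv0I⟩ := hnot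
  let V : Submodule K (Module.End Λ P) :=
    { carrier := {v | ∀ x, v x ∈ F k}
      add_mem' := fun ha hb x => (F k).add_mem (ha x) (hb x)
      zero_mem' := fun x => (F k).zero_mem
      smul_mem' := fun c v hv x => Submodule.smul_of_tower_mem (F k) c (hv x) }
  have hV : ∀ v, v ∈ V ↔ ∀ x, v x ∈ F k := fun v => Iff.rfl
  have hA : ∀ n v : Module.End Λ P, (∀ x, n x ∈ jrad Λ P) → v ∈ V → n * v ∈ I := by
    intro n v hn hv
    apply hspec
    intro x
    rw [hFs']
    have h1 : (F k).map n ≤ jacRad Λ ^ k • jrad Λ P := by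
      simp only [F]
      rw [Submodule.map_smul'']
      refine smul_mono_right _ ?_
      rintro _ ⟨y, _, rfl⟩
      exact hn y
    exact h1 ⟨v x, hv x, rfl⟩
  have hA' : ∀ n v : Module.End Λ P, (∀ x, n x ∈ jrad Λ P) → v ∈ V → v * n ∈ I := by
    intro n v hn hv
    apply hspec
    intro x
    rw [hFs]
    have h1 : (jrad Λ P).map v ≤ jacRad Λ • F k := by
      rw [aux_jrad_eq, Submodule.map_smul'']
      refine smul_mono_right _ ?_
      rintro _ ⟨y, _, rfl⟩
      exact hv y
    exact h1 ⟨n x, hn x, rfl⟩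
  let Op : Set (Module.End Λ P →ₗ[K] Module.End Λ P) :=
    {s | ∃ x, s = LinearMap.mulLeft K x ∨ s = LinearMap.mulRight K x}
  obtain ⟨f, _, hfI, hf⟩ := aux_eig Op I V (by
      rintro s ⟨x, rfl | rfl⟩ g hg
      · exact hl x g hg
      · exact hr x g hg) (by
      rintro s ⟨x, rfl | rfl⟩ g hg
      · intro y
        exact hFmap k x _ (hg y)
      · intro y
        exact hg (x y)) (by
      rintro s ⟨x, rfl | rfl⟩ t ⟨y, rfl | rfl⟩ v hv
      · have := hA (x * y - y * x) v (fun z => hcomm x y z) hv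
        convert this using 1
        simp only [LinearMap.mulLeft_apply]; noncomm_ring
      · simp only [LinearMap.mulLeft_apply, LinearMap.mulRight_apply, mul_assoc, sub_self]
        exact I.zero_mem
      · simp only [LinearMap.mulLeft_apply, LinearMap.mulRight_apply, mul_assoc, sub_self]
        exact I.zero_mem
      · have := hA' (y * x - x * y) v (fun z => hcomm y x z) hv
        convert this using 1
        simp only [LinearMap.mulRight_apply]; noncomm_ring) ⟨v0, hv0, hv0I⟩
  exact ⟨f, hfI, fun x => hf _ ⟨x, Or.inl rfl⟩, fun x => hf _ ⟨x, Or.inr rfl⟩⟩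

theorem aux_kill {ι : Type} [Fintype ι] (b : Basis ι K Λ) (d : ℕ)
    (ρ τ : Λ →ₐ[K] Matrix (Fin d) (Fin d) K) (h : IsDegeneration b d ρ τ) (a : Λ)
    (ha : ρ a = 0) : τ a = 0 := by
  have hsum : ∀ σ : Λ →ₐ[K] Matrix (Fin d) (Fin d) K, σ a = ∑ k, b.repr a k • σ (b k) := by
    intro σ
    conv_lhs => rw [← b.sum_repr a]
    rw [map_sum]
    simp only [map_smul]
  ext i j
  have := h (∑ k, MvPolynomial.C (b.repr a k) * MvPolynomial.X (k, i, j)) (by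
    intro g
    have h1 : (g : Matrix (Fin d) (Fin d) K) * ρ a *
            ((g⁻¹ : GL (Fin d) K) : Matrix (Fin d) (Fin d) K) = 0 := by rw [ha]; simp
    rw [hsum, Finset.mul_sum, Finset.sum_mul] at h1
    have h2 := congrFun (congrFun h1 i) j
    rw [Matrix.sum_apply] at h2
    simpa using h2)
  rw [hsum, Matrix.sum_apply]
  simpa using this

end Aux5
/-- Let `T` be a squarefree semisimple `Λ`-module with projective cover `P`
and `d ≥ 1`.  Then no `d`-dimensional `Λ`-module with top isomorphic to `T` has a proper
top-stable degeneration if and only if every `Λ`-submodule `C ⊆ JP` with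
`dim_K (P ⧸ C) = d` is invariant under all `Λ`-endomorphisms of `P`. -/
theorem stmt0 {K Λ ι : Type} [Field K] [IsAlgClosed K] [Ring Λ] [Algebra K Λ]
    [FiniteDimensional K Λ] [Fintype ι] (b : Basis ι K Λ)
    (T : Type) [AddCommGroup T] [Module Λ T] [Module K T] [IsScalarTower K Λ T]
    [FiniteDimensional K T]
    (P : Type) [AddCommGroup P] [Module Λ P] [Module K P] [IsScalarTower K Λ P]
    [FiniteDimensional K P]
    -- `T` is semisimple and squarefree (distinct simple submodules are non-isomorphic,
    -- i.e. every simple module occurs at most once as a direct summand of `T`):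
    (hss : IsSemisimpleModule Λ T)
    (hsf : ∀ S S' : Submodule Λ T, IsSimpleModule Λ ↥S → IsSimpleModule Λ ↥S' →
        Nonempty (↥S ≃ₗ[Λ] ↥S') → S = S')
    -- `P` is a projective cover of `T`, i.e. projective with `P/JP ≅ T`:
    (hproj : Module.Projective Λ P)
    (hcover : Nonempty ((P ⧸ jrad Λ P) ≃ₗ[Λ] T))
    (d : ℕ) (hd : 1 ≤ d) :
    -- (i) every top-stable degeneration of a `d`-dimensional module with top `T` is improper:
    (∀ ρ τ : Λ →ₐ[K] Matrix (Fin d) (Fin d) K,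
        Nonempty ((RepSpace K d ρ ⧸ jrad Λ (RepSpace K d ρ)) ≃ₗ[Λ] T) →
        IsDegeneration b d ρ τ →
        Nonempty ((RepSpace K d τ ⧸ jrad Λ (RepSpace K d τ)) ≃ₗ[Λ]
          (RepSpace K d ρ ⧸ jrad Λ (RepSpace K d ρ))) →
        Nonempty (RepSpace K d τ ≃ₗ[Λ] RepSpace K d ρ))
    ↔
    -- (ii) every submodule `C ⊆ JP` with `dim_K (P/C) = d` is fully invariant in `P`:
    (∀ C : Submodule Λ P, C ≤ jrad Λ P → finrank K (P ⧸ C) = d →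
        ∀ f : P →ₗ[Λ] P, C.map f ≤ C) := by
  have hfinP : Module.Finite Λ P := Module.Finite.of_restrictScalars_finite K Λ P
  have hnoe : IsNoetherian Λ P := isNoetherian_of_tower K inferInstance
  have hinf : Infinite K := IsAlgClosed.instInfinite
  obtain ⟨eT⟩ := hcover
  constructor
  · intro hi
    let Valid : Submodule Λ P → Prop := fun C => C ≤ jrad Λ P ∧ finrank K (P ⧸ C) = d
    let I : Submodule K (Module.End Λ P) :=
      { carrier := {x | ∀ a c : Module.End Λ P, ∀ C, Valid C → ∀ y ∈ C, a (x (c y)) ∈ C}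
        add_mem' := by
          intro x x' hx hx' a c C hC y hy
          rw [LinearMap.add_apply, map_add]
          exact C.add_mem (hx a c C hC y hy) (hx' a c C hC y hy)
        zero_mem' := by
          intro a c C hC y hy
          rw [LinearMap.zero_apply, map_zero]
          exact C.zero_mem
        smul_mem' := by
          intro k x hx a c C hC y hy
          rw [LinearMap.smul_apply, LinearMap.map_smul_of_tower]
          exact Submodule.smul_of_tower_mem C k (hx a c C hC y hy) }
    have hl : ∀ x, ∀ g ∈ I, x * g ∈ I := fun x g hg a c C hC y hy =>
      hg (a * x) c C hC y hy
    have hr : ∀ x, ∀ g ∈ I, g * x ∈ I := fun x g hg a c C hC y hy =>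
      hg a (x * c) C hC y hy
    have hinv : ∀ C, Valid C → ∀ x ∈ I, ∀ y ∈ C, x y ∈ C := fun C hC x hx y hy =>
      hx 1 1 C hC y hy
    have htop : I = ⊤ := by
      by_contra hne
      obtain ⟨f, hfI, hfl, hfr⟩ := aux_findf
        (aux_comm_top (K := K) T P hss hsf eT) I hl hr hne
      apply hfI
      intro a c C hC y hy
      obtain ⟨l, hlf⟩ := hfl f
      obtain ⟨C0, hC0, hfC0, hrk, B, S, hS, hB⟩ := aux_step I hl C (hinv C hC) f l hlf
      have hC0v : Valid C0 := by
        refine ⟨?_, ?_⟩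
        · rw [hC0]
          exact sup_le (inf_le_left.trans hC.1) ((Submodule.map_mono hC.1).trans (aux_jrad_map_le f))
        · have h1 := Submodule.finrank_quotient_add_finrank (C.restrictScalars K)
          have h2 := Submodule.finrank_quotient_add_finrank (C0.restrictScalars K)
          have h3 : finrank K (P ⧸ C) + finrank K C = finrank K P := h1
          have h4 : finrank K (P ⧸ C0) + finrank K C0 = finrank K P := h2
          have h5 := hC.2
          omega
      obtain ⟨ρ, p, hps, hpk⟩ := aux_rep C d hC.2
      obtain ⟨τ, q, hqs, hqk⟩ := aux_rep C0 d hC0v.2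
      have hdeg : IsDegeneration b d ρ τ := by
        refine aux_family b d ρ τ P (p.restrictScalars K) (q.restrictScalars K)
          (fun a x => p.map_smul a x) (fun a x => q.map_smul a x) hqs B S hS ?_
        intro t ht
        obtain ⟨v, hv⟩ := hB t ht
        refine ⟨v, fun x => ?_⟩
        have := hv x
        rw [← hpk, ← hqk, LinearMap.mem_ker, LinearMap.mem_ker] at this
        exact this
      obtain ⟨t1⟩ := aux_top p hps (hpk.le.trans hC.1)
      obtain ⟨t2⟩ := aux_top q hqs (hqk.le.trans hC0v.1)
      obtain ⟨e⟩ := hi ρ τ ⟨t1.trans eT⟩ hdeg ⟨t2.trans t1.symm⟩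
      obtain ⟨h, hh⟩ := aux_auto hproj p q hps hqs (hpk.le.trans hC.1) e
      rw [hpk, hqk] at hh
      let hE : Module.End Λ P := h.toLinearMap
      let hE' : Module.End Λ P := h.symm.toLinearMap
      obtain ⟨μ, hμ⟩ := hfl (hE' * a)
      obtain ⟨ν, hν⟩ := hfr (c * hE)
      have hx : h.symm y ∈ C0 := by
        rw [← hh, LinearEquiv.apply_symm_apply]; exact hy
      have hz : h.symm (a (f (c y))) ∈ C0 := by
        have h1 := hinv C0 hC0v _ (hr (c * hE) _ hμ) _ hx
        have h2 := hinv C0 hC0v _ hν _ hx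
        have h3 := hfC0 _ hx
        have h4 := C0.add_mem h1 (Submodule.smul_of_tower_mem C0 μ
          (C0.add_mem h2 (Submodule.smul_of_tower_mem C0 ν h3)))
        convert h4 using 1
        simp [hE, hE']
      rw [← hh, LinearEquiv.apply_symm_apply] at hz
      exact hz
    rintro C hCJ hCd f _ ⟨y, hy, rfl⟩
    exact hinv C ⟨hCJ, hCd⟩ f (by rw [htop]; trivial) y hy
  · intro hii ρ τ htρ hdeg htτ
    obtain ⟨tρ⟩ := htρ
    obtain ⟨tτ⟩ := htτ
    have hfk : ∀ σ : Λ →ₐ[K] Matrix (Fin d) (Fin d) K, FiniteDimensional K (RepSpace K d σ) :=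
      fun σ => inferInstanceAs (FiniteDimensional K (Fin d → K))
    have hfrk : ∀ σ : Λ →ₐ[K] Matrix (Fin d) (Fin d) K, finrank K (RepSpace K d σ) = d :=
      fun σ => (show finrank K (Fin d → K) = d by simp)
    have hfin : ∀ σ : Λ →ₐ[K] Matrix (Fin d) (Fin d) K, Module.Finite Λ (RepSpace K d σ) :=
      fun σ => Module.Finite.of_restrictScalars_finite K Λ _
    obtain ⟨p, hps, hpk⟩ := aux_cover (N := RepSpace K d ρ) hproj (eT.trans tρ.symm)
    obtain ⟨q, hqs, hqk⟩ := aux_cover (N := RepSpace K d τ) hproj (eT.trans (tτ.trans tρ).symm)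
    have hpe := LinearMap.quotKerEquivOfSurjective p hps
    have hqe := LinearMap.quotKerEquivOfSurjective q hqs
    have hpd : finrank K (P ⧸ LinearMap.ker p) = d :=
      ((hpe.restrictScalars K).finrank_eq).trans (hfrk ρ)
    have hqd : finrank K (P ⧸ LinearMap.ker q) = d :=
      ((hqe.restrictScalars K).finrank_eq).trans (hfrk τ)
    have hall : ∀ f : P →ₗ[Λ] RepSpace K d ρ, ∀ x ∈ LinearMap.ker p, f x = 0 := by
      intro f x hx
      obtain ⟨h, hh⟩ := Module.projective_lifting_property p f hps
      have := hii _ hpk hpd h ⟨x, hx, rfl⟩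
      rw [← hh]
      exact this
    obtain ⟨s, hs⟩ := Module.projective_def'.1 hproj
    have hle : LinearMap.ker p ≤ LinearMap.ker q := by
      intro x hx
      have h1 : ∀ i, τ (s x i) = 0 := by
        intro i
        apply aux_kill b d ρ τ hdeg
        have h2 : ∀ n : RepSpace K d ρ, s x i • n = 0 := by
          intro n
          exact hall ((LinearMap.toSpanSingleton Λ _ n) ∘ₗ (Finsupp.lapply i) ∘ₗ s) x hx
        apply Matrix.toLin'.injective
        rw [map_zero]
        refine LinearMap.ext fun n => ?_
        exact h2 n
      have h3 := LinearMap.congr_fun hs x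
      rw [LinearMap.comp_apply, LinearMap.id_apply, Finsupp.linearCombination_apply] at h3
      rw [LinearMap.mem_ker, ← h3, Finsupp.sum, map_sum]
      refine Finset.sum_eq_zero fun i _ => ?_
      rw [map_smul]
      have h5 : ∀ n : Fin d → K, (τ (s x i)).mulVec n = 0 := by
        intro n
        rw [h1, Matrix.zero_mulVec]
      exact h5 _
    have heq : LinearMap.ker p = LinearMap.ker q := by
      have h1 := Submodule.finrank_quotient_add_finrank ((LinearMap.ker p).restrictScalars K)
      have h2 := Submodule.finrank_quotient_add_finrank ((LinearMap.ker q).restrictScalars K)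
      have h3 : finrank K (P ⧸ LinearMap.ker p) + finrank K ((LinearMap.ker p).restrictScalars K)
        = finrank K P := h1
      have h4 : finrank K (P ⧸ LinearMap.ker q) + finrank K ((LinearMap.ker q).restrictScalars K)
        = finrank K P := h2
      apply Submodule.restrictScalars_injective K Λ P
      apply Submodule.eq_of_le_of_finrank_eq
      · exact hle
      · omega
    exact ⟨hqe.symm.trans ((Submodule.quotEquivOfEq _ _ heq.symm).trans hpe)⟩
end

section
/- No finite-dimensional Λ-module M with simple top has a proper layer-stable degeneration: if M' is a degeneration of M with J^l M'/J^{l+1} M' ≅ J^l M/J^{l+1} M for all l ≥ 0, then M' ≅ M. -/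
open Module

/-- The chain of submodules `J^l • M` of a `Λ`-module `M`. -/
noncomputable def radPow (Λ : Type) [Ring Λ] (M : Type) [AddCommGroup M] [Module Λ M] :
    ℕ → Submodule Λ M
  | 0 => ⊤
  | l + 1 => Submodule.span Λ {x : M | ∃ a ∈ jacRad Λ, ∃ m ∈ radPow Λ M l, a • m = x}

/-- The `l`-th radical layer `J^l M / J^{l+1} M` of a `Λ`-module `M`. -/
noncomputable abbrev radLayer (Λ : Type) [Ring Λ] (M : Type) [AddCommGroup M] [Module Λ M]
    (l : ℕ) : Type :=
  ↥(radPow Λ M l) ⧸ (Submodule.comap (radPow Λ M l).subtype (radPow Λ M (l + 1)))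

section part1
variable {Λ : Type} [Ring Λ] {M M' : Type} [AddCommGroup M] [Module Λ M]
  [AddCommGroup M'] [Module Λ M']

lemma radPow_smul_mem_succ {l : ℕ} {a : Λ} (ha : a ∈ jacRad Λ) {m : M} (hm : m ∈ radPow Λ M l) :
    a • m ∈ radPow Λ M (l + 1) :=
  Submodule.subset_span ⟨a, ha, m, hm, rfl⟩

lemma radPow_succ_le (l : ℕ) : radPow Λ M (l + 1) ≤ radPow Λ M l := by
  refine Submodule.span_le.2 ?_
  rintro _ ⟨a, _, m, hm, rfl⟩
  exact Submodule.smul_mem _ _ hm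

lemma radPow_antitone : Antitone (radPow Λ M) := antitone_nat_of_succ_le radPow_succ_le

lemma jrad_eq : jrad Λ M = radPow Λ M 1 := by
  simp [jrad, radPow]

lemma radPow_map_mem (f : M →ₗ[Λ] M') : ∀ (l : ℕ) {m : M}, m ∈ radPow Λ M l →
    f m ∈ radPow Λ M' l
  | 0, _, _ => Submodule.mem_top
  | l + 1, m, hm => by
    have : radPow Λ M (l + 1) ≤ (radPow Λ M' (l + 1)).comap f := by
      refine Submodule.span_le.2 ?_
      rintro _ ⟨a, ha, m, hm, rfl⟩
      simp only [SetLike.mem_coe, Submodule.mem_comap, map_smul]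
      exact radPow_smul_mem_succ ha (radPow_map_mem f l hm)
    exact this hm

lemma radPow_map_surj (f : M →ₗ[Λ] M') (hf : Function.Surjective f) : ∀ (l : ℕ) {m' : M'},
    m' ∈ radPow Λ M' l → ∃ m ∈ radPow Λ M l, f m = m'
  | 0, m', _ => by
    obtain ⟨m, rfl⟩ := hf m'
    exact ⟨m, Submodule.mem_top, rfl⟩
  | l + 1, m', hm => by
    have : radPow Λ M' (l + 1) ≤ (radPow Λ M (l + 1)).map f := by
      refine Submodule.span_le.2 ?_
      rintro _ ⟨a, ha, m', hm', rfl⟩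
      obtain ⟨m, hm, rfl⟩ := radPow_map_surj f hf l hm'
      exact ⟨a • m, radPow_smul_mem_succ ha hm, by simp⟩
    exact this hm

lemma radPow_smul_mem {i : ℕ} {z : M} (hz : z ∈ radPow Λ M i) : ∀ (k : ℕ) {a : Λ},
    a ∈ radPow Λ Λ k → a • z ∈ radPow Λ M (k + i)
  | 0, a, _ => by simpa using Submodule.smul_mem _ _ hz
  | k + 1, a, ha => by
    have : radPow Λ Λ (k + 1) ≤ (radPow Λ M (k + 1 + i)).comap
        (LinearMap.toSpanSingleton Λ M z) := by
      refine Submodule.span_le.2 ?_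
      rintro _ ⟨a, ha, m, hm, rfl⟩
      simp only [SetLike.mem_coe, Submodule.mem_comap, LinearMap.toSpanSingleton_apply,
        smul_assoc]
      have := radPow_smul_mem_succ ha (radPow_smul_mem hz k hm)
      rwa [show k + 1 + i = k + i + 1 by omega]
    exact this ha

lemma radPow_smul_mem' {k : ℕ} {a : Λ} (ha : a ∈ radPow Λ Λ k) (z : M) :
    a • z ∈ radPow Λ M k :=
  radPow_smul_mem (i := 0) (z := z) Submodule.mem_top k ha

lemma radPow_gen {x : M} (hx : ∀ m : M, ∃ a : Λ, a • x = m) {l : ℕ} {m : M}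
    (hm : m ∈ radPow Λ M l) : ∃ a ∈ radPow Λ Λ l, a • x = m :=
  radPow_map_surj (LinearMap.toSpanSingleton Λ M x) (fun m => hx m) l hm

lemma radPow_eq_bot [IsArtinianRing Λ] : ∃ r, ∀ (l : ℕ), r ≤ l → radPow Λ M l = ⊥ := by
  obtain ⟨r, hr⟩ := IsArtinianRing.isNilpotent_jacobson_bot (R := Λ)
  have key : ∀ l, radPow Λ M l ≤ ((Ideal.jacobson (⊥ : Ideal Λ)) ^ l) • (⊤ : Submodule Λ M) := by
    intro l
    induction l with
    | zero => simp [radPow, Submodule.pow_zero, Ideal.one_eq_top]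
    | succ l ih =>
      refine Submodule.span_le.2 ?_
      rintro _ ⟨a, ha, m, hm, rfl⟩
      rw [Ideal.IsTwoSided.pow_succ, ← smul_eq_mul, Submodule.smul_assoc]
      exact Submodule.smul_mem_smul ha (ih hm)
  refine ⟨r, fun l hl => ?_⟩
  have h1 : radPow Λ M r = ⊥ := by
    have := key r
    rw [hr] at this
    simpa using this
  exact le_bot_iff.1 ((radPow_antitone hl).trans h1.le)

lemma radPow_nakayama [IsArtinianRing Λ] (L : Submodule Λ M) (h : L ⊔ radPow Λ M 1 = ⊤) :
    L = ⊤ := by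
  obtain ⟨r, hr⟩ := radPow_eq_bot (Λ := Λ) (M := M)
  have key : ∀ l, L ⊔ radPow Λ M l = ⊤ := by
    intro l
    induction l with
    | zero => simp [radPow]
    | succ l ih =>
      rw [eq_top_iff, ← ih]
      refine sup_le le_sup_left ?_
      cases l with
      | zero => rw [zero_add, h]; exact le_top
      | succ l =>
        refine Submodule.span_le.2 ?_
        rintro _ ⟨a, ha, m, hm, rfl⟩
        have hm' : m ∈ L ⊔ radPow Λ M (l + 1) := ih ▸ Submodule.mem_top
        obtain ⟨y, hy, z, hz, rfl⟩ := Submodule.mem_sup.1 hm'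
        rw [smul_add]
        exact Submodule.add_mem_sup (Submodule.smul_mem _ _ hy) (radPow_smul_mem_succ ha hz)
  have := key r
  rwa [hr r le_rfl, sup_bot_eq] at this

lemma gen_of_notMem [IsArtinianRing Λ] (hs : IsCoatom (radPow Λ M 1)) {x : M}
    (hx : x ∉ radPow Λ M 1) (m : M) : ∃ a : Λ, a • x = m := by
  have h : Submodule.span Λ {x} = ⊤ := by
    apply radPow_nakayama
    rw [sup_comm]
    apply hs.2
    refine lt_of_le_of_ne le_sup_left fun h => hx ?_
    rw [h]
    exact Submodule.mem_sup_right (Submodule.mem_span_singleton_self x)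
  exact Submodule.mem_span_singleton.1 (h ▸ Submodule.mem_top)

/-- the zeroth layer is the top -/
noncomputable def layerZero : radLayer Λ M 0 ≃ₗ[Λ] (M ⧸ radPow Λ M 1) :=
  Submodule.Quotient.equiv _ _ (Submodule.topEquiv : (⊤ : Submodule Λ M) ≃ₗ[Λ] M) (by
    ext m
    simp only [Submodule.mem_map, Submodule.mem_comap]
    constructor
    · rintro ⟨y, hy, rfl⟩; exact hy
    · intro hm; exact ⟨⟨m, Submodule.mem_top⟩, hm, rfl⟩)

lemma exists_e_simple {K : Type} [Field K] [IsAlgClosed K] [Algebra K Λ] (T : Type)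
    [AddCommGroup T] [Module Λ T] [Module K T]
    [IsScalarTower K Λ T] [FiniteDimensional K T] [IsSimpleModule Λ T] :
    ∃ (e : Λ) (t : T) (φ : T →ₗ[K] K), t ≠ 0 ∧ φ t = 1 ∧ ∀ z : T, e • z = φ z • t := by
  have : Nontrivial T := IsSimpleModule.nontrivial Λ T
  obtain ⟨t, ht⟩ := exists_ne (0 : T)
  obtain ⟨φ, hφ⟩ : ∃ φ : T →ₗ[K] K, φ t = 1 := by
    obtain ⟨φ, h, _⟩ := (⊥ : Submodule K T).exists_le_ker_of_notMem (v := t) (by simpa using ht)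
    exact ⟨(φ t)⁻¹ • φ, by simp [h]⟩
  let E : Module.End (Module.End Λ T) T :=
    { toFun := fun z => φ z • t
      map_add' := by intro a b; simp [add_smul]
      map_smul' := by
        intro q z
        obtain ⟨c, rfl⟩ := (IsSimpleModule.algebraMap_end_bijective_of_isAlgClosed K
          (A := Λ) (V := T)).2 q
        simp [mul_smul] }
  classical
  let bs := Module.finBasis K T
  obtain ⟨e, he⟩ := jacobson_density (R := Λ) (M := T) E (Finset.univ.image bs)
  refine ⟨e, t, φ, ht, hφ, fun z => ?_⟩
  have : (Module.toModuleEnd K T e : T →ₗ[K] T) = φ.smulRight t := by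
    refine bs.ext fun i => ?_
    have := he (bs i) (by simp)
    exact this.symm
  exact congrArg (fun F : T →ₗ[K] T => F z) this

lemma exists_e {K : Type} [Field K] [IsAlgClosed K] [Algebra K Λ] [Module K M]
    [IsScalarTower K Λ M] [FiniteDimensional K M] (hs : IsSimpleModule Λ (M ⧸ radPow Λ M 1)) :
    ∃ (e : Λ) (x : M), x ∉ radPow Λ M 1 ∧ (∀ m : M, ∃ c : K, e • m - c • x ∈ radPow Λ M 1) ∧
      ∃ m : M, e • m ∉ radPow Λ M 1 := by
  have : FiniteDimensional K (M ⧸ radPow Λ M 1) :=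
    inferInstanceAs (FiniteDimensional K (M ⧸ (radPow Λ M 1).restrictScalars K))
  obtain ⟨e, t, φ, ht, hφ, he'⟩ := exists_e_simple (Λ := Λ) (K := K) (M ⧸ radPow Λ M 1)
  obtain ⟨x, rfl⟩ := Submodule.mkQ_surjective _ t
  refine ⟨e, x, fun h => ht (by simpa using h), fun m => ⟨φ ((radPow Λ M 1).mkQ m), ?_⟩, x, ?_⟩
  · rw [← Submodule.Quotient.mk_eq_zero, Submodule.Quotient.mk_sub, Submodule.Quotient.mk_smul,
      Submodule.Quotient.mk_smul]
    have := he' ((radPow Λ M 1).mkQ m)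
    simp only [Submodule.mkQ_apply] at this ⊢
    rw [this, sub_self]
  · rw [← Submodule.Quotient.mk_eq_zero, Submodule.Quotient.mk_smul]
    have := he' ((radPow Λ M 1).mkQ x)
    rw [hφ, one_smul] at this
    simp only [Submodule.mkQ_apply] at this ht ⊢
    rwa [this]

lemma finrank_radPow_eq {K : Type} [Field K] [Algebra K Λ] [Module K M] [Module K M']
    [IsScalarTower K Λ M] [FiniteDimensional K M] [IsScalarTower K Λ M'] [FiniteDimensional K M']
    (h0 : Module.finrank K M = Module.finrank K M')
    (hl : ∀ l : ℕ, Nonempty (radLayer Λ M l ≃ₗ[Λ] radLayer Λ M' l)) (l : ℕ) :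
    Module.finrank K (radPow Λ M l) = Module.finrank K (radPow Λ M' l) := by
  have key : ∀ (X : Type) [AddCommGroup X] [Module Λ X] [Module K X] [IsScalarTower K Λ X]
      [FiniteDimensional K X] (l : ℕ), Module.finrank K (radLayer Λ X l) +
        Module.finrank K (radPow Λ X (l+1)) = Module.finrank K (radPow Λ X l) := by
    intro X _ _ _ _ _ l
    have : FiniteDimensional K (radPow Λ X l) :=
      inferInstanceAs (FiniteDimensional K ((radPow Λ X l).restrictScalars K))
    let S : Submodule Λ (radPow Λ X l) :=
      Submodule.comap (radPow Λ X l).subtype (radPow Λ X (l + 1))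
    have h1 := Submodule.finrank_quotient_add_finrank (S.restrictScalars K)
    have e1 : S ≃ₗ[Λ] radPow Λ X (l+1) := Submodule.comapSubtypeEquivOfLe (radPow_succ_le l)
    have h2 := (e1.restrictScalars K).finrank_eq
    have h3 : Module.finrank K (radLayer Λ X l) = 
      Module.finrank K ((radPow Λ X l) ⧸ (S.restrictScalars K)) := rfl
    rw [h3, ← h2]
    exact h1
  induction l with
  | zero =>
    have : ∀ (X : Type) [AddCommGroup X] [Module Λ X] [Module K X] [IsScalarTower K Λ X],
      Module.finrank K (radPow Λ X 0) = Module.finrank K X := by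
      intro X _ _ _ _
      exact ((Submodule.topEquiv : (⊤ : Submodule Λ X) ≃ₗ[Λ] X).restrictScalars K).finrank_eq
    rw [this, this, h0]
  | succ l ih =>
    have h1 := key M l
    have h2 := key M' l
    have h3 := ((hl l).some.restrictScalars K).finrank_eq
    omega
end part1
section part2

/-- the maximal ideal as a `K`-subspace -/
noncomputable def mSub {K F : Type} [Field K] [Field F] [Algebra K F] (O : ValuationSubring F)
    (hK : ∀ k : K, algebraMap K F k ∈ O) : Submodule K F where
  carrier := {z | O.valuation z < 1}
  add_mem' := fun {a b} ha hb => lt_of_le_of_lt (O.valuation.map_add a b) (max_lt ha hb)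
  zero_mem' := by simp
  smul_mem' := by
    intro k z hz
    simp only [Set.mem_ofPred_eq] at hz ⊢
    rw [Algebra.smul_def, map_mul]
    exact (mul_le_of_le_one_left' ((O.valuation_le_one_iff _).2 (hK k))).trans_lt hz

/-- the valuation ring as a `K`-subspace -/
noncomputable def oSub {K F : Type} [Field K] [Field F] [Algebra K F] (O : ValuationSubring F)
    (hK : ∀ k : K, algebraMap K F k ∈ O) : Submodule K F where
  carrier := {z | z ∈ O}
  add_mem' := fun {a b} ha hb => O.add_mem _ _ ha hb
  zero_mem' := O.zero_mem
  smul_mem' := by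
    intro k z hz
    simp only [Set.mem_ofPred_eq] at hz ⊢
    rw [Algebra.smul_def]
    exact O.mul_mem _ _ (hK k) hz

lemma exists_valuation {K Λ ι : Type} [Field K] [Ring Λ] [Algebra K Λ]
    [Fintype ι] (b : Basis ι K Λ) (d : ℕ)
    (ρ τ : Λ →ₐ[K] Matrix (Fin d) (Fin d) K) (hdeg : IsDegeneration b d ρ τ) :
    ∃ (F : Type) (_ : Field F) (_ : Algebra K F) (O : ValuationSubring F)
      (hK : ∀ k : K, algebraMap K F k ∈ O) (g h : Matrix (Fin d) (Fin d) F),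
      g * h = 1 ∧ h * g = 1 ∧ ∀ a i j, (g * (ρ a).map (algebraMap K F) * h -
        (τ a).map (algebraMap K F)) i j ∈ mSub O hK := by
  classical
  let P := MvPolynomial (Fin d × Fin d) K
  let X : Matrix (Fin d) (Fin d) P := Matrix.mvPolynomialX (Fin d) (Fin d) K
  have hX : X.det ≠ 0 := Matrix.det_mvPolynomialX_ne_zero (Fin d) K
  let A := Localization.Away X.det
  have hle : Submonoid.powers X.det ≤ nonZeroDivisors P :=
    powers_le_nonZeroDivisors_of_noZeroDivisors hX
  have : IsDomain A := IsLocalization.isDomain_localization hle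
  let F := FractionRing A
  let gA : Matrix (Fin d) (Fin d) A := X.map (algebraMap P A)
  have hgA : IsUnit gA.det := by
    have : gA.det = algebraMap P A X.det := by
      rw [RingHom.map_det]; rfl
    rw [this]
    exact IsLocalization.Away.algebraMap_isUnit X.det
  let hA := gA⁻¹
  have gh : gA * hA = 1 := Matrix.mul_nonsing_inv _ hgA
  have hg : hA * gA = 1 := Matrix.nonsing_inv_mul _ hgA
  let Q := MvPolynomial (ι × Fin d × Fin d) K
  let φ : Q →ₐ[K] A := MvPolynomial.aeval
    (fun x => (gA * (ρ (b x.1)).map (algebraMap K A) * hA) x.2.1 x.2.2)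
  let ev : Q →ₐ[K] K := MvPolynomial.aeval (fun x => τ (b x.1) x.2.1 x.2.2)
  have key : ∀ p : Q, φ p = 0 → ev p = 0 := by
    intro p hp
    have h1 := hdeg p
    refine Eq.trans (DFunLike.congr_fun (MvPolynomial.coe_aeval_eq_eval _) p) (h1 ?_)
    intro g0
    let e0 : P →ₐ[K] K := MvPolynomial.aeval (fun x => (g0 : Matrix _ _ K) x.1 x.2)
    have he0 : X.map e0 = (g0 : Matrix (Fin d) (Fin d) K) := by
      ext i j
      simp only [X, e0, Matrix.mvPolynomialX, Matrix.map_apply, Matrix.of_apply]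
      rw [MvPolynomial.aeval_X]
    have hu : IsUnit (e0 X.det) := by
      have h2 : e0 X.det = (g0 : Matrix (Fin d) (Fin d) K).det := by
        rw [← he0, AlgHom.map_det]; rfl
      rw [h2]
      exact (Matrix.isUnit_iff_isUnit_det _).1 g0.isUnit
    let ψ0 : A →+* K := IsLocalization.Away.lift (S := A) (g := e0.toRingHom) X.det hu
    have hψ : ∀ p, ψ0 (algebraMap P A p) = e0 p := fun p => IsLocalization.Away.lift_eq _ hu p
    let ψ : A →ₐ[K] K := { ψ0 with
      commutes' := fun k => by
        have := hψ (algebraMap K P k)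
        rw [AlgHom.commutes, ← IsScalarTower.algebraMap_apply] at this
        exact this }
    have hψ' : ∀ p, ψ (algebraMap P A p) = e0 p := hψ
    have hgm : gA.map ψ = (g0 : Matrix (Fin d) (Fin d) K) := by
      rw [← he0]
      ext i j
      simp [gA, hψ']
    have hhm : hA.map ψ = ((g0⁻¹ : GL (Fin d) K) : Matrix (Fin d) (Fin d) K) := by
      have h3 : (g0 : Matrix (Fin d) (Fin d) K) * hA.map ψ = 1 := by
        rw [← hgm, ← Matrix.map_mul, gh]; simp
      have h4 : ((g0⁻¹ : GL (Fin d) K) : Matrix (Fin d) (Fin d) K) * g0 = 1 := by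
        rw [← Units.val_mul]; simp
      calc hA.map ψ = ((g0⁻¹ : GL (Fin d) K) : Matrix (Fin d) (Fin d) K) * g0 * hA.map ψ := by
            rw [h4, one_mul]
        _ = _ := by rw [mul_assoc, h3, mul_one]
    have h5 : ψ (φ p) = 0 := by rw [hp, map_zero]
    have h6 : ψ.comp φ = MvPolynomial.aeval (fun x => ((g0 : Matrix (Fin d) (Fin d) K) * ρ (b x.1) *
            ((g0⁻¹ : GL (Fin d) K) : Matrix (Fin d) (Fin d) K)) x.2.1 x.2.2) := by
      apply MvPolynomial.algHom_ext
      intro x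
      have h7 : (gA * (ρ (b x.1)).map (algebraMap K A) * hA).map ψ =
        (g0 : Matrix (Fin d) (Fin d) K) * ρ (b x.1) *
            ((g0⁻¹ : GL (Fin d) K) : Matrix (Fin d) (Fin d) K) := by
        rw [Matrix.map_mul, Matrix.map_mul, hgm, hhm]
        congr 2
        ext i j
        simp
      simp only [φ, AlgHom.comp_apply, MvPolynomial.aeval_X]
      rw [← h7]; rfl
    have h8 := DFunLike.congr_fun h6 p
    rw [AlgHom.comp_apply, h5] at h8
    exact Eq.trans (DFunLike.congr_fun (MvPolynomial.coe_aeval_eq_eval _) p).symm h8.symm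
  let ιF : A →ₐ[K] F := IsScalarTower.toAlgHom K A F
  have hinj : Function.Injective ιF := IsFractionRing.injective A F
  let φF : Q →ₐ[K] F := ιF.comp φ
  let B : Subring F := φF.toRingHom.range
  let I : Ideal B := (RingHom.ker ev).map φF.toRingHom.rangeRestrict
  have hI : I ≠ ⊤ := by
    intro h
    have h1 : (1 : B) ∈ I := h ▸ Submodule.mem_top
    obtain ⟨p, hp, hp1⟩ := (Ideal.mem_map_iff_of_surjective _
      φF.toRingHom.rangeRestrict_surjective).1 h1
    have h2 : φF p = 1 := congrArg Subtype.val hp1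
    have h3 : φ (p - 1) = 0 := by
      apply hinj
      rw [map_zero, map_sub, map_sub, map_one, map_one, sub_eq_zero]
      exact h2
    have h4 := key _ h3
    rw [map_sub, map_one, (RingHom.mem_ker).1 hp] at h4
    simp at h4
  obtain ⟨O, hBO, hnonu⟩ := Ideal.image_subset_nonunits_valuationSubring I hI
  have hK : ∀ k : K, algebraMap K F k ∈ O := by
    intro k
    apply hBO
    exact ⟨algebraMap K Q k, φF.commutes k⟩
  refine ⟨F, inferInstance, inferInstance, O, hK, gA.map ιF, hA.map ιF, ?_, ?_, ?_⟩
  · rw [← Matrix.map_mul, gh]; simp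
  · rw [← Matrix.map_mul, hg]; simp
  intro a i j
  have hbasis : ∀ t, (gA.map ιF * (ρ (b t)).map (algebraMap K F) * hA.map ιF -
        (τ (b t)).map (algebraMap K F)) i j ∈ mSub O hK := by
    intro t
    let p : Q := MvPolynomial.X (t, i, j) - MvPolynomial.C (τ (b t) i j)
    have hp : p ∈ RingHom.ker ev := by
      rw [RingHom.mem_ker]
      simp only [p, ev, map_sub]
      rw [MvPolynomial.aeval_X, MvPolynomial.aeval_C]
      simp
    have h1 : (φF.toRingHom.rangeRestrict p) ∈ I := Ideal.mem_map_of_mem _ hp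
    have h2 := hnonu ⟨_, h1, rfl⟩
    replace h2 := (ValuationSubring.mem_nonunits_iff O).1 (SetLike.mem_coe.1 h2)
    have h3 : φF p = (gA.map ιF * (ρ (b t)).map (algebraMap K F) * hA.map ιF -
        (τ (b t)).map (algebraMap K F)) i j := by
      have h4 : (ρ (b t)).map (algebraMap K F) = ((ρ (b t)).map (algebraMap K A)).map ιF := by
        ext i j
        simp
      rw [h4, ← Matrix.map_mul, ← Matrix.map_mul]
      have h5 : φF (MvPolynomial.C (τ (b t) i j)) = algebraMap K F (τ (b t) i j) :=
        φF.commutes _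
      simp only [p, map_sub, h5, Matrix.sub_apply, Matrix.map_apply]
      simp only [φF, φ, AlgHom.comp_apply]
      rw [MvPolynomial.aeval_X]
    rw [← h3]
    exact h2
  have hspan : a ∈ Submodule.span K (Set.range b) := by rw [b.span_eq]; exact Submodule.mem_top
  induction hspan using Submodule.span_induction with
  | mem x hx => obtain ⟨t, rfl⟩ := hx; exact hbasis t
  | zero => simp
  | add x y _ _ hx hy =>
    have := Submodule.add_mem _ hx hy
    convert this using 1
    simp only [map_add, Matrix.map_add _ (map_add (algebraMap K F)), mul_add, add_mul,
      Matrix.sub_apply, Matrix.add_apply]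
    ring
  | smul k x _ hx =>
    have := Submodule.smul_mem _ k hx
    convert this using 1
    have h1 : ∀ N : Matrix (Fin d) (Fin d) K, (k • N).map (algebraMap K F) =
      k • N.map (algebraMap K F) := by
      intro N; ext i j; simp only [Matrix.map_apply, Matrix.smul_apply, smul_eq_mul, map_mul, Algebra.smul_def k (_ : F)]
    simp only [map_smul, h1, Matrix.mul_smul, Matrix.smul_mul, Matrix.sub_apply,
      Matrix.smul_apply, smul_sub]
end part2
section part3
open Matrix

instance instFDRep (K : Type) [Field K] (d : ℕ) {Λ : Type} [Ring Λ] [Algebra K Λ]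
    (ρ : Λ →ₐ[K] Matrix (Fin d) (Fin d) K) : FiniteDimensional K (RepSpace K d ρ) :=
  inferInstanceAs (FiniteDimensional K (Fin d → K))

variable {K F Λ : Type} [Field K] [Field F] [Algebra K F] [Ring Λ] [Algebra K Λ] {d : ℕ}
  (ρ τ : Λ →ₐ[K] Matrix (Fin d) (Fin d) K)

lemma finrank_rep : Module.finrank K (RepSpace K d ρ) = d := by
  have : Module.finrank K (Fin d → K) = d := by simp
  exact this

lemma rep_smul (a : Λ) (v : RepSpace K d ρ) : a • v = (ρ a) *ᵥ (v : Fin d → K) := by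
  show (Matrix.toLinAlgEquiv' (ρ a)) v = _
  exact Matrix.toLinAlgEquiv'_apply (ρ a) v

/-- apply a functional to all coordinates -/
def app (f : F →ₗ[K] K) : (Fin d → F) →ₗ[K] RepSpace K d ρ where
  toFun v := (fun i => f (v i) : Fin d → K)
  map_add' v w := by
    show (fun i => f ((v + w) i) : Fin d → K) = (fun i => f (v i)) + (fun i => f (w i))
    ext i; simp
  map_smul' k v := by
    show (fun i => f ((k • v) i) : Fin d → K) = k • (fun i => f (v i) : Fin d → K)
    ext i; simp

lemma app_apply (f : F →ₗ[K] K) (v : Fin d → F) (i : Fin d) :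
    (app ρ f v : Fin d → K) i = f (v i) := rfl

/-- base change of a vector -/
def emb (F : Type) [Field F] [Algebra K F] (x : RepSpace K d ρ) : Fin d → F :=
  fun i => algebraMap K F ((x : Fin d → K) i)

lemma app_emb (f : F →ₗ[K] K) (x : RepSpace K d ρ) : app ρ f (emb ρ F x) = f 1 • x := by
  show (fun i => f (algebraMap K F ((x : Fin d → K) i)) : Fin d → K) = f 1 • (x : Fin d → K)
  ext i
  rw [Algebra.algebraMap_eq_smul_one, map_smul]
  exact mul_comm _ _

lemma app_matrix (f : F →ₗ[K] K) (A : Matrix (Fin d) (Fin d) K) (v : Fin d → F) :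
    app ρ f (A.map (algebraMap K F) *ᵥ v) = A *ᵥ (app ρ f v : Fin d → K) := by
  show (fun i => f ((A.map (algebraMap K F) *ᵥ v) i) : Fin d → K) = A *ᵥ (fun i => f (v i))
  ext i
  simp only [Matrix.mulVec, dotProduct, map_sum, Matrix.map_apply]
  refine Finset.sum_congr rfl fun j _ => ?_
  rw [← Algebra.smul_def, map_smul, smul_eq_mul]

/-- base change of the action -/
abbrev RF (F : Type) [Field F] [Algebra K F] (a : Λ) : Matrix (Fin d) (Fin d) F :=
  (ρ a).map (algebraMap K F)

lemma app_RF (f : F →ₗ[K] K) (a : Λ) (v : Fin d → F) :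
    app ρ f (RF ρ F a *ᵥ v) = a • app ρ f v := by
  rw [app_matrix, rep_smul]

lemma RF_mul (a b : Λ) : RF ρ F (a * b) = RF ρ F a * RF ρ F b := by
  simp [RF, Matrix.map_mul]

lemma RF_emb (a : Λ) (x : RepSpace K d ρ) : RF ρ F a *ᵥ emb ρ F x = emb ρ F (a • x) := by
  rw [rep_smul]
  ext i
  simp [RF, emb, Matrix.mulVec, dotProduct]

lemma emb_add (x y : RepSpace K d ρ) : emb ρ F (x + y) = emb ρ F x + emb ρ F y := by
  ext i; exact map_add _ _ _

lemma emb_zero : emb ρ F (0 : RepSpace K d ρ) = 0 := by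
  ext i; exact map_zero _

lemma emb_smul (k : K) (y : RepSpace K d ρ) :
    emb ρ F (k • y) = algebraMap K F k • emb ρ F y := by
  ext i; exact map_mul _ _ _

lemma app_smul (f : F →ₗ[K] K) (c : F) (v : Fin d → F) :
    app ρ f (c • v) = app ρ (f.comp (LinearMap.mulLeft K c)) v := rfl

/-- base change of a subspace -/
def exS (F : Type) [Field F] [Algebra K F] (W : Submodule K (RepSpace K d ρ)) :
    Submodule F (Fin d → F) where
  carrier := {v | ∀ f : F →ₗ[K] K, app ρ f v ∈ W}
  add_mem' := fun {a b} ha hb f => by rw [map_add]; exact W.add_mem (ha f) (hb f)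
  zero_mem' := fun f => by rw [map_zero]; exact W.zero_mem
  smul_mem' := fun c v hv f => by rw [app_smul]; exact hv _

lemma mem_exS {W : Submodule K (RepSpace K d ρ)} {v : Fin d → F} :
    v ∈ exS ρ F W ↔ ∀ f : F →ₗ[K] K, app ρ f v ∈ W := Iff.rfl

lemma decomp (S : Submodule K F) (v : Fin d → F) (hv : ∀ i, v i ∈ S) :
    ∃ (n : ℕ) (o : Fin n → F) (f : Fin n → (F →ₗ[K] K)), (∀ a, o a ∈ S) ∧
      v = ∑ a, o a • emb ρ F (app ρ (f a) v) := by
  let S' := Submodule.span K (Set.range v)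
  have hS' : S' ≤ S := Submodule.span_le.2 (by rintro _ ⟨i, rfl⟩; exact hv i)
  have : FiniteDimensional K S' := FiniteDimensional.span_of_finite K (Set.finite_range v)
  let bs := Module.finBasis K S'
  choose f hf using fun a => LinearMap.exists_extend (bs.coord a)
  refine ⟨_, fun a => bs a, f, fun a => hS' (bs a).2, ?_⟩
  ext i
  have h1 := bs.sum_repr ⟨v i, Submodule.subset_span ⟨i, rfl⟩⟩
  have h2 := congrArg Subtype.val h1
  simp only at h2
  rw [← h2]
  simp only [Finset.sum_apply, Pi.smul_apply, AddSubmonoidClass.coe_finsetSum]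
  refine Finset.sum_congr rfl fun a _ => ?_
  have h3 : f a (v i) = bs.repr ⟨v i, Submodule.subset_span ⟨i, rfl⟩⟩ a := by
    rw [← Module.Basis.coord_apply, ← hf a]; rfl
  show _ = (bs a : F) • algebraMap K F (f a (v i))
  rw [h3, Submodule.coe_smul, Algebra.smul_def, smul_eq_mul, mul_comm]

lemma eq_zero_of_app {v : Fin d → F} (hv : ∀ f : F →ₗ[K] K, app ρ f v = 0) : v = 0 := by
  obtain ⟨n, o, f, -, h⟩ := decomp ρ ⊤ v (fun _ => Submodule.mem_top)
  rw [h]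
  exact Finset.sum_eq_zero fun a _ => by rw [hv, emb_zero, smul_zero]

lemma finrank_exS_le (W : Submodule K (RepSpace K d ρ)) :
    Module.finrank F (exS ρ F W) ≤ Module.finrank K W := by
  let bs := Module.finBasis K W
  have h1 : exS ρ F W ≤ Submodule.span F (Set.range fun a => emb ρ F (bs a : RepSpace K d ρ)) := by
    intro v hv
    obtain ⟨n, o, f, -, h⟩ := decomp ρ ⊤ v (fun _ => Submodule.mem_top)
    rw [h]
    refine Submodule.sum_mem _ fun a _ => Submodule.smul_mem _ _ ?_
    have hw : app ρ (f a) v ∈ W := hv _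
    have h2 := congrArg Subtype.val (bs.sum_repr ⟨_, hw⟩)
    simp only [AddSubmonoidClass.coe_finsetSum, Submodule.coe_smul] at h2
    rw [← h2]
    let E : RepSpace K d ρ →+ (Fin d → F) := ⟨⟨emb ρ F, emb_zero ρ⟩, emb_add ρ⟩
    show E _ ∈ _
    rw [map_sum]
    refine Submodule.sum_mem _ fun t _ => ?_
    show emb ρ F _ ∈ _
    rw [emb_smul]
    exact Submodule.smul_mem _ _ (Submodule.subset_span ⟨t, rfl⟩)
  calc _ ≤ _ := Submodule.finrank_mono h1
    _ ≤ _ := finrank_range_le_card _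
    _ = _ := by simp

lemma split_exS (S : Submodule K F) (W W' : Submodule K (RepSpace K d ρ)) (hW : W' ≤ W)
    (j : Fin d → F) (hj : j ∈ exS ρ F W)
    (hj' : ∀ f : F →ₗ[K] K, (∀ z ∈ S, f z = 0) → app ρ f j ∈ W') :
    ∃ j' j'' : Fin d → F, j = j' + j'' ∧ j' ∈ exS ρ F W ∧ (∀ i, j' i ∈ S) ∧
      j'' ∈ exS ρ F W' := by
  obtain ⟨s, hs⟩ := LinearMap.exists_leftInverse_of_injective W'.subtype (by simp)
  let s' : (Fin d → K) →ₗ[K] (Fin d → K) := W'.subtype.comp s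
  have hs' : ∀ w : RepSpace K d ρ, w ∈ W' → s' w = w := by
    intro w hw
    have := DFunLike.congr_fun hs ⟨w, hw⟩
    exact congrArg Subtype.val this
  have hs'' : ∀ w : RepSpace K d ρ, (s' w : RepSpace K d ρ) ∈ W' := fun w => (s w).2
  let A := LinearMap.toMatrix' s'
  have hA : ∀ (f : F →ₗ[K] K) v, app ρ f (A.map (algebraMap K F) *ᵥ v) = s' (app ρ f v) := by
    intro f v
    rw [app_matrix]
    exact LinearMap.toMatrix'_mulVec _ _
  have hj2 : A.map (algebraMap K F) *ᵥ j ∈ exS ρ F W' := by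
    intro f
    rw [hA]
    exact hs'' _
  refine ⟨j - A.map (algebraMap K F) *ᵥ j, A.map (algebraMap K F) *ᵥ j, by simp, ?_, ?_, hj2⟩
  · intro f
    rw [map_sub]
    exact W.sub_mem (hj f) (hW (hj2 f))
  · intro i
    by_contra hi
    obtain ⟨f, hf, hf2⟩ := S.exists_le_ker_of_notMem hi
    have h1 : app ρ f (j - A.map (algebraMap K F) *ᵥ j) = 0 := by
      rw [map_sub, hA, hs' _ (hj' f fun z hz => hf2 hz), sub_self]
    exact hf (congrFun h1 i)

end part3
section part4
open Matrix

/-- the degeneration data over a valuation ring -/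
structure Dat {K Λ : Type} [Field K] [Ring Λ] [Algebra K Λ] {d : ℕ}
    (ρ τ : Λ →ₐ[K] Matrix (Fin d) (Fin d) K) (F : Type) [Field F] [Algebra K F] where
  O : ValuationSubring F
  hK : ∀ k : K, algebraMap K F k ∈ O
  g : Matrix (Fin d) (Fin d) F
  h : Matrix (Fin d) (Fin d) F
  gh : g * h = 1
  hg : h * g = 1
  red : ∀ a i j, (g * RF ρ F a * h - RF τ F a) i j ∈ mSub O hK

variable {K F Λ : Type} [Field K] [Field F] [Algebra K F] [Ring Λ] [Algebra K Λ] {d : ℕ}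
  {ρ τ : Λ →ₐ[K] Matrix (Fin d) (Fin d) K} (D : Dat ρ τ F)

namespace Dat

lemma m_le_o {z : F} (hz : z ∈ mSub D.O D.hK) : z ∈ D.O :=
  (D.O.valuation_le_one_iff z).1 (le_of_lt hz)

lemma m_mul {z c : F} (hz : z ∈ mSub D.O D.hK) (hc : c ∈ D.O) : z * c ∈ mSub D.O D.hK := by
  show D.O.valuation (z * c) < 1
  rw [map_mul]
  exact (mul_le_of_le_one_right' ((D.O.valuation_le_one_iff c).2 hc)).trans_lt hz

lemma one_notMem : (1 : F) ∉ mSub D.O D.hK := by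
  show ¬ (D.O.valuation 1 < 1)
  simp

/-- the lattice -/
def N : Submodule D.O (Fin d → F) where
  carrier := {v | ∀ i, (D.g *ᵥ v) i ∈ D.O}
  add_mem' := fun {a b} ha hb i => by
    rw [mulVec_add]; exact D.O.add_mem _ _ (ha i) (hb i)
  zero_mem' := fun i => by rw [mulVec_zero]; exact D.O.zero_mem
  smul_mem' := fun c v hv i => by
    have : D.g *ᵥ (c • v) = (c : F) • (D.g *ᵥ v) := mulVec_smul _ (c : F) v
    rw [this]
    exact D.O.mul_mem _ _ c.2 (hv i)

lemma mem_N {v : Fin d → F} : v ∈ D.N ↔ ∀ i, (D.g *ᵥ v) i ∈ D.O := Iff.rfl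

lemma g_RF (a : Λ) (v : Fin d → F) : D.g *ᵥ (RF ρ F a *ᵥ v) =
    (D.g * RF ρ F a * D.h - RF τ F a) *ᵥ (D.g *ᵥ v) + RF τ F a *ᵥ (D.g *ᵥ v) := by
  rw [← add_mulVec, sub_add_cancel, mulVec_mulVec, mulVec_mulVec, mul_assoc _ D.h, D.hg, mul_one]

lemma diff_mem (a : Λ) {v : Fin d → F} (hv : v ∈ D.N) (i : Fin d) :
    ((D.g * RF ρ F a * D.h - RF τ F a) *ᵥ (D.g *ᵥ v)) i ∈ mSub D.O D.hK := by
  simp only [mulVec, dotProduct]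
  exact Submodule.sum_mem _ fun j _ => D.m_mul (D.red a i j) (hv j)

lemma N_stable (a : Λ) {v : Fin d → F} (hv : v ∈ D.N) : RF ρ F a *ᵥ v ∈ D.N := by
  intro i
  rw [D.g_RF]
  refine D.O.add_mem _ _ (D.m_le_o (D.diff_mem a hv i)) ?_
  simp only [mulVec, dotProduct]
  exact sum_mem fun j _ => D.O.mul_mem _ _ (D.hK _) (hv j)

lemma app_red {f : F →ₗ[K] K} (hf : ∀ z ∈ mSub D.O D.hK, f z = 0) (a : Λ) {v : Fin d → F}
    (hv : v ∈ D.N) : app τ f (D.g *ᵥ (RF ρ F a *ᵥ v)) = a • app τ f (D.g *ᵥ v) := by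
  rw [D.g_RF, map_add, app_RF]
  have : app τ f ((D.g * RF ρ F a * D.h - RF τ F a) *ᵥ (D.g *ᵥ v)) = 0 := by
    refine funext (α := Fin d) fun i => ?_
    exact hf _ (D.diff_mem a hv i)
  rw [this, zero_add]

lemma kill_mul {f : F →ₗ[K] K} (hf : ∀ z ∈ mSub D.O D.hK, f z = 0) {c : F} (hc : c ∈ D.O) :
    ∀ z ∈ mSub D.O D.hK, (f.comp (LinearMap.mulLeft K c)) z = 0 := by
  intro z hz
  simp only [LinearMap.comp_apply, LinearMap.mulLeft_apply]
  rw [mul_comm]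
  exact hf _ (D.m_mul hz hc)

/-- the lattice `J^l n` -/
def B (l : ℕ) (n : Fin d → F) : Submodule D.O (Fin d → F) :=
  Submodule.span D.O {w | ∃ a ∈ radPow Λ Λ l, RF ρ F a *ᵥ n = w}

lemma key_max {l : ℕ} {y : RepSpace K d τ} {n : Fin d → F} (hn : n ∈ D.N)
    (hny : ∀ i, (D.g *ᵥ n - emb τ F y) i ∈ mSub D.O D.hK)
    {r : ℕ} (bs : Basis (Fin r) K (radPow Λ (RepSpace K d τ) l)) (μ : Fin r → Λ)
    (hμ : ∀ a, μ a • y = (bs a : RepSpace K d τ)) (c : Fin r → F) (hc : ∀ a, c a ∈ D.O)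
    (a₀ : Fin r) (ha₀ : c a₀ = 1)
    (hz : ∀ i, (D.g *ᵥ (∑ a, c a • (RF ρ F (μ a) *ᵥ n))) i ∈ mSub D.O D.hK) : False := by
  obtain ⟨f, hf1, hf⟩ := (mSub D.O D.hK).exists_le_ker_of_notMem D.one_notMem
  have hf' : ∀ z ∈ mSub D.O D.hK, f z = 0 := fun z hz => hf hz
  have h1 : app τ f (D.g *ᵥ (∑ a, c a • (RF ρ F (μ a) *ᵥ n))) = 0 := by
    refine funext (α := Fin d) fun i => ?_
    exact hf' _ (hz i)
  have h2 : ∀ f' : F →ₗ[K] K, (∀ z ∈ mSub D.O D.hK, f' z = 0) →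
      app τ f' (D.g *ᵥ n) = f' 1 • y := by
    intro f' hf'
    have h3 : app τ f' (D.g *ᵥ n - emb τ F y) = 0 := by
      refine funext (α := Fin d) fun i => ?_
      exact hf' _ (hny i)
    rw [map_sub, app_emb, sub_eq_zero] at h3
    exact h3
  have h4 : ∑ a, f (c a) • bs a = 0 := by
    apply Subtype.ext
    simp only [AddSubmonoidClass.coe_finsetSum, Submodule.coe_smul_of_tower, ZeroMemClass.coe_zero]
    rw [← h1, mulVec_sum, map_sum]
    refine Finset.sum_congr rfl fun a _ => ?_
    rw [mulVec_smul, app_smul, D.app_red (D.kill_mul hf' (hc a)) _ hn,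
      h2 _ (D.kill_mul hf' (hc a)), ← hμ, smul_comm]
    simp
  have h5 := Fintype.linearIndependent_iff.1 bs.linearIndependent _ h4 a₀
  rw [ha₀] at h5
  exact hf1 h5

lemma N_inter [IsArtinianRing Λ] {y : RepSpace K d τ}
    (hy : ∀ m : RepSpace K d τ, ∃ a : Λ, a • y = m)
    {n : Fin d → F} (hn : n ∈ D.N) (hny : ∀ i, (D.g *ᵥ n - emb τ F y) i ∈ mSub D.O D.hK)
    (l : ℕ) (hr : Module.finrank K (radPow Λ (RepSpace K d τ) l) =
      Module.finrank K (radPow Λ (RepSpace K d ρ) l))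
    {w : Fin d → F} (hw : w ∈ D.N)
    (hw' : w ∈ exS ρ F ((radPow Λ (RepSpace K d ρ) l).restrictScalars K)) : w ∈ D.B l n := by
  have : FiniteDimensional K (radPow Λ (RepSpace K d τ) l) :=
    inferInstanceAs (FiniteDimensional K ((radPow Λ (RepSpace K d τ) l).restrictScalars K))
  let bs := Module.finBasis K (radPow Λ (RepSpace K d τ) l)
  choose μ hμJ hμ using fun a => radPow_gen hy (bs a).2
  have hind : LinearIndependent F (fun a => RF ρ F (μ a) *ᵥ n) := by
    rw [Fintype.linearIndependent_iff]
    intro c hc a1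
    by_contra hne
    have : Nonempty (Fin (Module.finrank K (radPow Λ (RepSpace K d τ) l))) := ⟨a1⟩
    obtain ⟨a₀, ha₀⟩ := Finite.exists_max (fun a => D.O.valuation (c a))
    have hne0 : c a₀ ≠ 0 := by
      intro h0
      have := ha₀ a1
      rw [h0, map_zero, le_zero_iff, map_eq_zero] at this
      exact hne this
    refine D.key_max hn hny bs μ hμ (fun a => (c a₀)⁻¹ * c a) (fun a => ?_) a₀
      (inv_mul_cancel₀ hne0) ?_
    · rw [← D.O.valuation_le_one_iff, map_mul, map_inv₀]
      have h0 : D.O.valuation (c a₀) ≠ 0 := by simpa using hne0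
      calc _ ≤ (D.O.valuation (c a₀))⁻¹ * D.O.valuation (c a₀) := by
            gcongr; exact ha₀ a
        _ = 1 := inv_mul_cancel₀ h0
    · have : ∑ a, ((c a₀)⁻¹ * c a) • (RF ρ F (μ a) *ᵥ n) = 0 := by
        simp only [mul_smul]
        rw [← Finset.smul_sum, hc, smul_zero]
      rw [this, mulVec_zero]
      intro i
      exact Submodule.zero_mem _
  have hle : Submodule.span F (Set.range fun a => RF ρ F (μ a) *ᵥ n) ≤
      exS ρ F ((radPow Λ (RepSpace K d ρ) l).restrictScalars K) := by
    rw [Submodule.span_le]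
    rintro _ ⟨a, rfl⟩ f
    rw [app_RF]
    exact radPow_smul_mem' (hμJ a) _
  have heq := Submodule.eq_of_le_of_finrank_le hle (by
    rw [finrank_span_eq_card hind, Fintype.card_fin, hr]
    exact finrank_exS_le ρ _)
  rw [← heq, Submodule.mem_span_range_iff_exists_fun] at hw'
  obtain ⟨c, rfl⟩ := hw'
  have hcO : ∀ a, c a ∈ D.O := by
    intro a1
    have : Nonempty (Fin (Module.finrank K (radPow Λ (RepSpace K d τ) l))) := ⟨a1⟩
    obtain ⟨a₀, ha₀⟩ := Finite.exists_max (fun a => D.O.valuation (c a))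
    rw [← D.O.valuation_le_one_iff]
    refine (ha₀ a1).trans ?_
    by_contra hlt
    rw [not_le] at hlt
    have h0 : D.O.valuation (c a₀) ≠ 0 := fun h0 => by rw [h0] at hlt; simp at hlt
    have hne0 : c a₀ ≠ 0 := by simpa using h0
    have hinv : (c a₀)⁻¹ ∈ mSub D.O D.hK := by
      show D.O.valuation (c a₀)⁻¹ < 1
      rw [map_inv₀]
      exact inv_lt_one_of_one_lt₀ hlt
    refine D.key_max hn hny bs μ hμ (fun a => (c a₀)⁻¹ * c a) (fun a => ?_) a₀
      (inv_mul_cancel₀ hne0) ?_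
    · rw [← D.O.valuation_le_one_iff, map_mul, map_inv₀]
      calc _ ≤ (D.O.valuation (c a₀))⁻¹ * D.O.valuation (c a₀) := by
            gcongr; exact ha₀ a
        _ = 1 := inv_mul_cancel₀ h0
    · intro i
      have : ∑ a, ((c a₀)⁻¹ * c a) • (RF ρ F (μ a) *ᵥ n) =
          (c a₀)⁻¹ • ∑ a, c a • (RF ρ F (μ a) *ᵥ n) := by
        simp only [mul_smul]
        rw [← Finset.smul_sum]
      rw [this, mulVec_smul]
      exact D.m_mul hinv (hw i)
  refine Submodule.sum_mem _ fun a _ => ?_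
  exact Submodule.smul_mem _ (⟨c a, hcO a⟩ : D.O) (Submodule.subset_span ⟨μ a, hμJ a, rfl⟩)

end Dat
end part4
section part5
open Matrix

variable {K F Λ : Type} [Field K] [Field F] [Algebra K F] [Ring Λ] [Algebra K Λ] {d : ℕ}
  {ρ τ : Λ →ₐ[K] Matrix (Fin d) (Fin d) K}

/-- the filtration of the radical by annihilator-compatible elements -/
def Lx (x : RepSpace K d ρ) (i : ℕ) : Submodule K (RepSpace K d ρ) where
  carrier := {j | j ∈ radPow Λ (RepSpace K d ρ) 1 ∧ ∀ (k : ℕ) (a : Λ), a ∈ radPow Λ Λ k →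
    a • x = 0 → a • j ∈ radPow Λ (RepSpace K d ρ) (k + i)}
  add_mem' := fun {u v} hu hv => ⟨Submodule.add_mem _ hu.1 hv.1, fun k a ha hx => by
    rw [smul_add]; exact Submodule.add_mem _ (hu.2 k a ha hx) (hv.2 k a ha hx)⟩
  zero_mem' := ⟨Submodule.zero_mem _, fun k a ha hx => by
    rw [smul_zero]; exact Submodule.zero_mem _⟩
  smul_mem' := fun c v hv => ⟨Submodule.smul_of_tower_mem _ c hv.1, fun k a ha hx => by
    have : a • c • v = c • a • v := by
      rw [← algebraMap_smul Λ c v, ← algebraMap_smul Λ c (a • v), smul_smul, smul_smul,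
        Algebra.commutes]
    rw [this]
    exact Submodule.smul_of_tower_mem _ c (hv.2 k a ha hx)⟩

lemma Lx_succ_le (x : RepSpace K d ρ) (i : ℕ) : Lx x (i + 1) ≤ Lx x i :=
  fun _ hj => ⟨hj.1, fun k a ha hx => radPow_succ_le _ (hj.2 k a ha hx)⟩

lemma mem_Lx_one (x : RepSpace K d ρ) {j : RepSpace K d ρ}
    (hj : j ∈ radPow Λ (RepSpace K d ρ) 1) : j ∈ Lx x 1 :=
  ⟨hj, fun k a ha _ => radPow_smul_mem hj k ha⟩

/-- the correction operator -/
def Top' (ρ : Λ →ₐ[K] Matrix (Fin d) (Fin d) K) {m : ℕ} (o : Fin m → F) (u : Fin m → Λ) :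
    (Fin d → F) →ₗ[F] (Fin d → F) :=
  ∑ a, o a • (RF ρ F (u a)).mulVecLin

lemma Top'_apply {m : ℕ} (o : Fin m → F) (u : Fin m → Λ) (v : Fin d → F) :
    Top' ρ o u v = ∑ a, o a • (RF ρ F (u a) *ᵥ v) := by
  simp [Top', LinearMap.sum_apply]

lemma app_Top' {m : ℕ} (o : Fin m → F) (u : Fin m → Λ) (v : Fin d → F) (f : F →ₗ[K] K) :
    app ρ f (Top' ρ o u v) =
      ∑ a, u a • app ρ (f.comp (LinearMap.mulLeft K (o a))) v := by
  rw [Top'_apply, map_sum]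
  refine Finset.sum_congr rfl fun a _ => ?_
  rw [app_smul, app_RF]

lemma Top'_nil {m : ℕ} (o : Fin m → F) (u : Fin m → Λ) (hu : ∀ a, u a ∈ radPow Λ Λ 1) (l : ℕ)
    (v : Fin d → F) (f : F →ₗ[K] K) :
    app ρ f (((-Top' ρ o u) ^ l) v) ∈ radPow Λ (RepSpace K d ρ) l := by
  induction l generalizing f with
  | zero => exact Submodule.mem_top
  | succ l ih =>
    rw [pow_succ', Module.End.mul_apply, LinearMap.neg_apply, map_neg, app_Top']
    refine Submodule.neg_mem _ (Submodule.sum_mem _ fun a _ => ?_)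
    have := radPow_smul_mem (ih (f.comp (LinearMap.mulLeft K (o a)))) 1 (hu a)
    rwa [add_comm] at this

lemma geom_mem {R : Type} [Ring R] {V : Type} [AddCommGroup V] [Module F V] [Module R V]
    (S : Submodule R V) (T : V →ₗ[F] V) (hT : ∀ v ∈ S, T v ∈ S) (r : ℕ) {v : V} (hv : v ∈ S) :
    (∑ i ∈ Finset.range r, (-T) ^ i) v ∈ S := by
  rw [LinearMap.sum_apply]
  refine Submodule.sum_mem _ fun i hi => ?_
  clear hi
  induction i with
  | zero => simpa using hv
  | succ i ih =>
    rw [pow_succ', Module.End.mul_apply, LinearMap.neg_apply]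
    exact Submodule.neg_mem _ (hT _ ih)

/-- the inductive invariant -/
def Invt (D : Dat ρ τ F) (f0 : F →ₗ[K] K) (x : RepSpace K d ρ) (i : ℕ) : Prop :=
  ∃ n j : Fin d → F, n = emb ρ F x + j ∧ j ∈ exS ρ F (Lx x i) ∧ n ∈ D.N ∧
    (∀ (l : ℕ) (w : Fin d → F), w ∈ D.N →
      w ∈ exS ρ F ((radPow Λ (RepSpace K d ρ) l).restrictScalars K) → w ∈ D.B l n) ∧
    app τ f0 (D.g *ᵥ n) ∉ radPow Λ (RepSpace K d τ) 1

lemma B_app (D : Dat ρ τ F) {x : RepSpace K d ρ} {n j : Fin d → F} (hn : n = emb ρ F x + j)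
    (hj : ∀ f : F →ₗ[K] K, app ρ f j ∈ radPow Λ (RepSpace K d ρ) 1) {l : ℕ} {w : Fin d → F}
    (hw : w ∈ D.B l n) : ∀ f : F →ₗ[K] K, (∀ z ∈ oSub D.O D.hK, f z = 0) →
      app ρ f w ∈ radPow Λ (RepSpace K d ρ) (l + 1) := by
  induction hw using Submodule.span_induction with
  | mem w hw =>
    obtain ⟨a, ha, rfl⟩ := hw
    intro f hf
    rw [app_RF, hn, map_add, app_emb, hf 1 D.O.one_mem, zero_smul, zero_add]
    exact radPow_smul_mem (hj f) l ha
  | zero => intro f _; rw [map_zero]; exact Submodule.zero_mem _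
  | add u v _ _ hu hv => intro f hf; rw [map_add]; exact Submodule.add_mem _ (hu f hf) (hv f hf)
  | smul c v _ hv =>
    intro f hf
    have : app ρ f (c • v) = app ρ (f.comp (LinearMap.mulLeft K (c : F))) v := app_smul ρ f (c : F) v
    rw [this]
    exact hv _ fun z hz => hf _ (D.O.mul_mem _ _ c.2 hz)

lemma B_app' (D : Dat ρ τ F) {n : Fin d → F} (hn : n ∈ D.N) {w : Fin d → F}
    (hw : w ∈ D.B 1 n) : ∀ f : F →ₗ[K] K, (∀ z ∈ mSub D.O D.hK, f z = 0) →
      app τ f (D.g *ᵥ w) ∈ radPow Λ (RepSpace K d τ) 1 := by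
  induction hw using Submodule.span_induction with
  | mem w hw =>
    obtain ⟨a, ha, rfl⟩ := hw
    intro f hf
    rw [D.app_red hf a hn]
    exact radPow_smul_mem' ha _
  | zero => intro f _; rw [mulVec_zero, map_zero]; exact Submodule.zero_mem _
  | add u v _ _ hu hv =>
    intro f hf; rw [mulVec_add, map_add]; exact Submodule.add_mem _ (hu f hf) (hv f hf)
  | smul c v _ hv =>
    intro f hf
    have : D.g *ᵥ (c • v) = (c : F) • (D.g *ᵥ v) := mulVec_smul _ (c : F) v
    rw [this, app_smul]
    exact hv _ (D.kill_mul hf c.2)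

lemma Invt_step [IsArtinianRing Λ] (D : Dat ρ τ F) {f0 : F →ₗ[K] K}
    (hf0 : ∀ z ∈ mSub D.O D.hK, f0 z = 0) {x : RepSpace K d ρ}
    (hx : ∀ m : RepSpace K d ρ, ∃ a : Λ, a • x = m) (i : ℕ) (H : Invt D f0 x i) :
    Invt D f0 x (i + 1) := by
  obtain ⟨n, j, hnj, hj, hnN, hB, hf⟩ := H
  have hjL : ∀ f : F →ₗ[K] K, (∀ z ∈ oSub D.O D.hK, f z = 0) → app ρ f j ∈ Lx x (i + 1) := by
    intro f hf
    refine ⟨(hj f).1, fun k a ha hax => ?_⟩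
    have h1 : RF ρ F a *ᵥ n = RF ρ F a *ᵥ j := by
      rw [hnj, mulVec_add, RF_emb, hax, emb_zero, zero_add]
    have h2 : RF ρ F a *ᵥ n ∈ D.B (k + i) n := by
      refine hB _ _ (D.N_stable a hnN) fun f' => ?_
      rw [h1, app_RF]
      exact (hj f').2 k a ha hax
    have h3 := B_app D hnj (fun f => (hj f).1) h2 f hf
    rwa [h1, app_RF] at h3
  obtain ⟨j', j'', rfl, hj', hj'O, hj''⟩ := split_exS ρ (oSub D.O D.hK) _ _ (Lx_succ_le x i) j hj hjL
  obtain ⟨m, o, f, ho, hdec⟩ := decomp ρ (oSub D.O D.hK) j' hj'O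
  choose u huJ hu using fun a => radPow_gen hx (hj' (f a)).1
  obtain ⟨r, hr⟩ := radPow_eq_bot (Λ := Λ) (M := RepSpace K d ρ)
  let T := Top' ρ o u
  have hTx : T (emb ρ F x) = j' := by
    rw [Top'_apply]
    conv_rhs => rw [hdec]
    refine Finset.sum_congr rfl fun a _ => ?_
    rw [RF_emb, hu]
  have hTr : (-T) ^ r = 0 := by
    refine LinearMap.ext fun v => eq_zero_of_app ρ fun f => ?_
    have := Top'_nil (ρ := ρ) o u huJ r v f
    rw [hr r le_rfl] at this
    exact this
  let P : (Fin d → F) →ₗ[F] (Fin d → F) := ∑ i ∈ Finset.range r, (-T) ^ i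
  have hP1 : (1 + T) * P = 1 := by
    have := mul_neg_geom_sum (-T) r
    rwa [hTr, sub_neg_eq_add, sub_zero] at this
  have hP2 : P * (1 + T) = 1 := by
    have := geom_sum_mul_neg (-T) r
    rwa [hTr, sub_neg_eq_add, sub_zero] at this
  have hTN : ∀ v ∈ D.N, T v ∈ D.N := by
    intro v hv
    rw [Top'_apply]
    exact Submodule.sum_mem _ fun a _ =>
      Submodule.smul_mem _ (⟨o a, ho a⟩ : D.O) (D.N_stable (u a) hv)
  have hTL : ∀ v ∈ exS ρ F (Lx x (i + 1)), T v ∈ exS ρ F (Lx x (i + 1)) := by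
    intro v hv f'
    rw [app_Top']
    refine Submodule.sum_mem _ fun a _ => ?_
    have hz := hv (f'.comp (LinearMap.mulLeft K (o a)))
    generalize app ρ (f'.comp (LinearMap.mulLeft K (o a))) v = z at hz
    refine ⟨Submodule.smul_mem _ _ hz.1, fun k b hb hbx => ?_⟩
    have h1 : (b * u a) • x ∈ radPow Λ (RepSpace K d ρ) (k + i) := by
      rw [mul_smul, hu]
      exact (hj' (f a)).2 k b hb hbx
    obtain ⟨s, hs, hsx⟩ := radPow_gen hx h1
    have h2 : b * u a - s ∈ radPow Λ Λ k := by
      refine Submodule.sub_mem _ ?_ (radPow_antitone (Nat.le_add_right k i) hs)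
      exact radPow_smul_mem' hb (u a)
    have h3 := hz.2 k _ h2 (by rw [sub_smul, hsx, sub_self])
    have h4 := radPow_smul_mem hz.1 (k + i) hs
    rw [smul_smul]
    have h5 : (b * u a) • z = (b * u a - s) • z + s • z := by rw [← add_smul, sub_add_cancel]
    rw [h5]
    exact Submodule.add_mem _ h3 h4
  have hPn : P n = emb ρ F x + P j'' := by
    have h1 : n = (1 + T) (emb ρ F x) + j'' := by
      rw [hnj, LinearMap.add_apply, Module.End.one_apply, hTx, add_assoc]
    rw [h1, map_add, ← Module.End.mul_apply, hP2, Module.End.one_apply]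
  have hn1 : n = P n + T (P n) := by
    have := congrArg (fun A : (Fin d → F) →ₗ[F] (Fin d → F) => A n) hP1
    simpa using this.symm
  have hPN : P n ∈ D.N := geom_mem D.N T hTN r hnN
  generalize P n = n' at hPn hn1 hPN
  refine ⟨n', P j'', hPn, geom_mem _ T hTL r hj'', hPN, fun l w hw hw' => ?_, fun hmem => hf ?_⟩
  · have hle : D.B l n ≤ D.B l n' := by
      refine Submodule.span_le.2 ?_
      rintro _ ⟨b, hb, rfl⟩
      rw [hn1, mulVec_add, Top'_apply, mulVec_sum]
      refine Submodule.add_mem _ (Submodule.subset_span ⟨b, hb, rfl⟩)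
        (Submodule.sum_mem _ fun a _ => ?_)
      rw [mulVec_smul, mulVec_mulVec, ← RF_mul]
      exact Submodule.smul_mem _ (⟨o a, ho a⟩ : D.O)
        (Submodule.subset_span ⟨b * u a, radPow_smul_mem' hb (u a), rfl⟩)
    exact hle (hB l w hw hw')
  · rw [hn1, mulVec_add, map_add, Top'_apply, mulVec_sum, map_sum]
    refine Submodule.add_mem _ hmem (Submodule.sum_mem _ fun a _ => ?_)
    rw [mulVec_smul, app_smul, D.app_red (D.kill_mul hf0 (ho a)) _ hPN]
    exact radPow_smul_mem' (huJ a) _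
end part5
section part6
open Matrix

variable {K F Λ : Type} [Field K] [Field F] [Algebra K F] [Ring Λ] [Algebra K Λ] {d : ℕ}
  {ρ τ : Λ →ₐ[K] Matrix (Fin d) (Fin d) K}

lemma emb_mem_exS {W : Submodule K (RepSpace K d ρ)} {w : RepSpace K d ρ} (hw : w ∈ W) :
    emb ρ F w ∈ exS ρ F W := by
  intro f
  rw [app_emb]
  exact W.smul_mem _ hw

lemma exists_c {e : Λ} {x : RepSpace K d ρ}
    (he : ∀ m : RepSpace K d ρ, ∃ c : K, e • m - c • x ∈ radPow Λ (RepSpace K d ρ) 1)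
    (v : Fin d → F) : ∃ (c : F) (j : Fin d → F), RF ρ F e *ᵥ v = c • emb ρ F x + j ∧
      j ∈ exS ρ F ((radPow Λ (RepSpace K d ρ) 1).restrictScalars K) := by
  obtain ⟨m, o, f, -, hv⟩ := decomp ρ ⊤ v (fun _ => Submodule.mem_top)
  choose c hc using fun a => he (app ρ (f a) v)
  refine ⟨∑ a, o a * algebraMap K F (c a),
    ∑ a, o a • emb ρ F (e • app ρ (f a) v - c a • x), ?_, ?_⟩
  · conv_lhs => rw [hv]
    rw [mulVec_sum, Finset.sum_smul, ← Finset.sum_add_distrib]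
    refine Finset.sum_congr rfl fun a _ => ?_
    rw [mulVec_smul, RF_emb, mul_smul, ← emb_smul, ← smul_add, ← emb_add, add_sub_cancel]
  · exact Submodule.sum_mem _ fun a _ => Submodule.smul_mem _ _ (emb_mem_exS (hc a))

lemma start_ny (D : Dat ρ τ F) (e : Λ) (y0 : RepSpace K d τ) (i : Fin d) :
    (D.g *ᵥ (RF ρ F e *ᵥ (D.h *ᵥ emb τ F y0)) - emb τ F (e • y0)) i ∈ mSub D.O D.hK := by
  have : D.g *ᵥ (RF ρ F e *ᵥ (D.h *ᵥ emb τ F y0)) - emb τ F (e • y0) =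
      (D.g * RF ρ F e * D.h - RF τ F e) *ᵥ emb τ F y0 := by
    rw [sub_mulVec, RF_emb, mulVec_mulVec, mulVec_mulVec, mul_assoc]
  rw [this]
  simp only [mulVec, dotProduct]
  exact Submodule.sum_mem _ fun j _ => D.m_mul (D.red e i j) (D.hK _)

lemma mem_N_of_ny (D : Dat ρ τ F) {n : Fin d → F} {y : RepSpace K d τ}
    (h : ∀ i, (D.g *ᵥ n - emb τ F y) i ∈ mSub D.O D.hK) : n ∈ D.N := by
  intro i
  have h2 := D.O.add_mem _ _ (D.m_le_o (h i)) (D.hK ((y : Fin d → K) i))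
  have h3 : (D.g *ᵥ n - emb τ F y) i + algebraMap K F ((y : Fin d → K) i) = (D.g *ᵥ n) i :=
    sub_add_cancel _ _
  rwa [h3] at h2

lemma app_ny (D : Dat ρ τ F) {n : Fin d → F} {y : RepSpace K d τ}
    (h : ∀ i, (D.g *ᵥ n - emb τ F y) i ∈ mSub D.O D.hK) {f : F →ₗ[K] K}
    (hf : ∀ z ∈ mSub D.O D.hK, f z = 0) : app τ f (D.g *ᵥ n) = f 1 • y := by
  have h3 : app τ f (D.g *ᵥ n - emb τ F y) = 0 :=
    funext (α := Fin d) fun i => hf _ (h i)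
  rwa [map_sub, app_emb, sub_eq_zero] at h3

/-- rescaling -/
def Dat.scale (D : Dat ρ τ F) (c : F) (hc : c ≠ 0) : Dat ρ τ F where
  O := D.O
  hK := D.hK
  g := c • D.g
  h := c⁻¹ • D.h
  gh := by rw [smul_mul_smul_comm, D.gh, mul_inv_cancel₀ hc, one_smul]
  hg := by rw [smul_mul_smul_comm, D.hg, inv_mul_cancel₀ hc, one_smul]
  red := by
    intro a i j
    have : c • D.g * RF ρ F a * c⁻¹ • D.h = D.g * RF ρ F a * D.h := by
      rw [smul_mul_assoc, smul_mul_smul_comm, mul_inv_cancel₀ hc, one_smul]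
    rw [this]
    exact D.red a i j

lemma smul_notMem {M : Type} [AddCommGroup M] [Module Λ M] [Module K M] [IsScalarTower K Λ M]
    (W : Submodule Λ M) {k : K} (hk : k ≠ 0) {y : M} (hy : y ∉ W) : k • y ∉ W := by
  intro h
  apply hy
  have := Submodule.smul_of_tower_mem W k⁻¹ h
  rwa [smul_smul, inv_mul_cancel₀ hk, one_smul] at this

lemma start [IsArtinianRing Λ] (D : Dat ρ τ F) {e : Λ} {x : RepSpace K d ρ}
    (he : ∀ m : RepSpace K d ρ, ∃ c : K, e • m - c • x ∈ radPow Λ (RepSpace K d ρ) 1)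
    {y0 : RepSpace K d τ} (hy0 : e • y0 ∉ radPow Λ (RepSpace K d τ) 1)
    (hy : ∀ m : RepSpace K d τ, ∃ a : Λ, a • (e • y0) = m)
    (hr : ∀ l, Module.finrank K (radPow Λ (RepSpace K d τ) l) =
      Module.finrank K (radPow Λ (RepSpace K d ρ) l)) :
    ∃ (D' : Dat ρ τ F) (f0 : F →ₗ[K] K), (∀ z ∈ mSub D'.O D'.hK, f0 z = 0) ∧
      Invt D' f0 x 1 := by
  obtain ⟨f0, hf1, hf⟩ := (mSub D.O D.hK).exists_le_ker_of_notMem D.one_notMem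
  have hf' : ∀ z ∈ mSub D.O D.hK, f0 z = 0 := fun z hz => hf hz
  have hny := start_ny D e y0
  obtain ⟨c, j, hcj, hj⟩ := exists_c he (D.h *ᵥ emb τ F y0)
  generalize RF ρ F e *ᵥ (D.h *ᵥ emb τ F y0) = n at hny hcj
  have hn := mem_N_of_ny D hny
  have hc : c ≠ 0 := by
    rintro rfl
    rw [zero_smul, zero_add] at hcj
    have h1 := D.N_inter hy hn hny 1 (hr 1) hn (hcj ▸ hj)
    have h2 := B_app' D hn h1 f0 hf'
    rw [app_ny D hny hf'] at h2
    exact smul_notMem _ hf1 hy0 h2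
  have hgn : (D.scale c hc).g *ᵥ (c⁻¹ • n) = D.g *ᵥ n := by
    show (c • D.g) *ᵥ (c⁻¹ • n) = _
    rw [smul_mulVec, mulVec_smul, smul_smul, mul_inv_cancel₀ hc, one_smul]
  have hny' : ∀ i, ((D.scale c hc).g *ᵥ (c⁻¹ • n) - emb τ F (e • y0)) i ∈
      mSub (D.scale c hc).O (D.scale c hc).hK := by
    intro i
    rw [hgn]
    exact hny i
  have hn' := mem_N_of_ny _ hny'
  refine ⟨D.scale c hc, f0, hf', c⁻¹ • n, c⁻¹ • j, ?_, ?_, hn', ?_, ?_⟩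
  · rw [hcj, smul_add, smul_smul, inv_mul_cancel₀ hc, one_smul]
  · refine Submodule.smul_mem _ _ fun f => mem_Lx_one x (hj f)
  · intro l w hw hw'
    exact (D.scale c hc).N_inter hy hn' hny' l (hr l) hw hw'
  · rw [hgn, app_ny D hny hf']
    exact smul_notMem _ hf1 hy0

lemma finish [IsArtinianRing Λ] (D : Dat ρ τ F) {f0 : F →ₗ[K] K}
    (hf0 : ∀ z ∈ mSub D.O D.hK, f0 z = 0) {x : RepSpace K d ρ}
    (hx : ∀ m : RepSpace K d ρ, ∃ a : Λ, a • x = m) (H : Invt D f0 x 1) :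
    ∃ y : RepSpace K d τ, y ∉ radPow Λ (RepSpace K d τ) 1 ∧ ∀ a : Λ, a • x = 0 → a • y = 0 := by
  have hall : ∀ i, Invt D f0 x (i + 1) := by
    intro i
    induction i with
    | zero => exact H
    | succ i ih => exact Invt_step D hf0 hx _ ih
  obtain ⟨r, hr⟩ := radPow_eq_bot (Λ := Λ) (M := RepSpace K d ρ)
  obtain ⟨n, j, hnj, hj, hn, -, hy⟩ := hall r
  refine ⟨_, hy, fun a ha => ?_⟩
  rw [← D.app_red hf0 a hn]
  have h0 : RF ρ F a *ᵥ n = 0 := by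
    rw [hnj, mulVec_add, RF_emb, ha, emb_zero, zero_add]
    refine eq_zero_of_app ρ fun f => ?_
    rw [app_RF]
    have h1 := (hj f).2 0 a Submodule.mem_top ha
    rw [hr _ (by omega)] at h1
    exact h1
  rw [h0, mulVec_zero, map_zero]

lemma equiv_of_gen {x : RepSpace K d ρ} {y : RepSpace K d τ}
    (hx : ∀ m : RepSpace K d ρ, ∃ a : Λ, a • x = m)
    (hy : ∀ m : RepSpace K d τ, ∃ a : Λ, a • y = m) (h : ∀ a : Λ, a • x = 0 → a • y = 0) :
    Nonempty (RepSpace K d τ ≃ₗ[Λ] RepSpace K d ρ) := by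
  let px := LinearMap.toSpanSingleton Λ (RepSpace K d ρ) x
  let py := LinearMap.toSpanSingleton Λ (RepSpace K d τ) y
  have hpx : Function.Surjective px := hx
  have hpy : Function.Surjective py := hy
  have hle : LinearMap.ker px ≤ LinearMap.ker py := fun a ha => h a ha
  let φ : RepSpace K d ρ →ₗ[Λ] RepSpace K d τ :=
    ((LinearMap.ker px).liftQ py hle).comp (px.quotKerEquivOfSurjective hpx).symm.toLinearMap
  have hφ : Function.Surjective φ := by
    refine Function.Surjective.comp (g := (LinearMap.ker px).liftQ py hle) ?_
      (px.quotKerEquivOfSurjective hpx).symm.surjective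
    intro m
    obtain ⟨a, ha⟩ := hpy m
    exact ⟨(LinearMap.ker px).mkQ a, ha⟩
  have hinj : Function.Injective (φ.restrictScalars K) :=
    (LinearMap.injective_iff_surjective_of_finrank_eq_finrank
      ((finrank_rep ρ).trans (finrank_rep τ).symm)).2 hφ
  exact ⟨(LinearEquiv.ofBijective φ ⟨hinj, hφ⟩).symm⟩
end part6

/-- No finite-dimensional `Λ`-module `M` with simple top has a proper
layer-stable degeneration: if `M'` is a degeneration of `M` with
`J^l M' / J^{l+1} M' ≅ J^l M / J^{l+1} M` for all `l ≥ 0`, then `M' ≅ M`. -/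
theorem stmt2 {K Λ ι : Type} [Field K] [IsAlgClosed K] [Ring Λ] [Algebra K Λ]
    [FiniteDimensional K Λ] [Fintype ι] (b : Basis ι K Λ) (d : ℕ)
    (ρ τ : Λ →ₐ[K] Matrix (Fin d) (Fin d) K)
    -- the top of `M = M_ρ` is simple:
    (hsimple : IsSimpleModule Λ (RepSpace K d ρ ⧸ jrad Λ (RepSpace K d ρ)))
    -- `M' = M_τ` is a degeneration of `M`:
    (hdeg : IsDegeneration b d ρ τ)
    -- which is layer-stable:
    (hlayers : ∀ l : ℕ,
      Nonempty (radLayer Λ (RepSpace K d τ) l ≃ₗ[Λ] radLayer Λ (RepSpace K d ρ) l)) :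
    -- then `M' ≅ M`:
    Nonempty (RepSpace K d τ ≃ₗ[Λ] RepSpace K d ρ) := by
  have : IsArtinianRing Λ := IsArtinianRing.of_finite K Λ
  rw [jrad_eq] at hsimple
  obtain ⟨e, x, hxJ, he, m1, hm1⟩ := exists_e (K := K) hsimple
  have hx := gen_of_notMem (isSimpleModule_iff_isCoatom.1 hsimple) hxJ
  let φ : (RepSpace K d ρ ⧸ radPow Λ (RepSpace K d ρ) 1) ≃ₗ[Λ]
      (RepSpace K d τ ⧸ radPow Λ (RepSpace K d τ) 1) :=
    layerZero.symm.trans ((hlayers 0).some.symm.trans layerZero)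
  have hsimple' : IsSimpleModule Λ (RepSpace K d τ ⧸ radPow Λ (RepSpace K d τ) 1) :=
    IsSimpleModule.congr φ.symm
  have hco := isSimpleModule_iff_isCoatom.1 hsimple'
  obtain ⟨y0, hy0⟩ := Submodule.mkQ_surjective _ (φ (Submodule.Quotient.mk m1))
  have hy0J : e • y0 ∉ radPow Λ (RepSpace K d τ) 1 := by
    intro h
    apply hm1
    rw [← Submodule.Quotient.mk_eq_zero, Submodule.Quotient.mk_smul] at h ⊢
    rw [Submodule.mkQ_apply] at hy0
    rw [hy0, ← map_smul] at h
    exact φ.map_eq_zero_iff.1 h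
  obtain ⟨F, _, _, O, hK, g, h, hgh, hhg, hred⟩ := exists_valuation b d ρ τ hdeg
  let D : Dat ρ τ F := ⟨O, hK, g, h, hgh, hhg, hred⟩
  obtain ⟨D', f0, hf0, hI⟩ := start D he hy0J (gen_of_notMem hco hy0J)
    (finrank_radPow_eq ((finrank_rep τ).trans (finrank_rep ρ).symm) hlayers)
  obtain ⟨y, hyJ, hy⟩ := finish D' hf0 hx hI
  exact equiv_of_gen hx (gen_of_notMem hco hyJ) hy
end
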